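/- arXiv:0809.1828 — 7 statements merged into one kernel-verified Lean document; each statement's English description precedes it below -/
import Mathlib

section
/- For every partial order P on a finite type and every module M of P, there exists a diametral pair (L₁, L₂) of linear extensions of P such that the elements of M occur consecutively in L₁ and occur consecutively in L₂ (i.e., M is an interval of each of the linear orders L₁ and L₂). -/
/-- `L` is a linear extension of the partial order `P`. -/
def IsLinExt {α : Type*} (P : PartialOrder α) (L : LinearOrder α) : Prop :=
  ∀ x y : α, P.le x y → L.le x y

/-- The distance between two linear orders: the number of ordered pairs `(x, y)` with
`x < y` in `L₁` and `y < x` in `L₂`. -/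
noncomputable def leDist {α : Type*} (L₁ L₂ : LinearOrder α) : ℕ :=
  Set.ncard {p : α × α | L₁.lt p.1 p.2 ∧ L₂.lt p.2 p.1}

/-- `(L₁, L₂)` is a diametral pair of linear extensions of `P`. -/
def IsDiametralPair {α : Type*} (P : PartialOrder α) (L₁ L₂ : LinearOrder α) : Prop :=
  IsLinExt P L₁ ∧ IsLinExt P L₂ ∧
    ∀ M₁ M₂ : LinearOrder α, IsLinExt P M₁ → IsLinExt P M₂ →
      leDist M₁ M₂ ≤ leDist L₁ L₂

/-- A linear extension is diametral if it belongs to some diametral pair. -/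
def IsDiametral {α : Type*} (P : PartialOrder α) (L : LinearOrder α) : Prop :=
  ∃ L' : LinearOrder α, IsDiametralPair P L L' ∨ IsDiametralPair P L' L

/-- The linear extension diameter of `P`. -/
noncomputable def led {α : Type*} (P : PartialOrder α) : ℕ :=
  sSup {d : ℕ | ∃ L₁ L₂ : LinearOrder α, IsLinExt P L₁ ∧ IsLinExt P L₂ ∧ leDist L₁ L₂ = d}

/-- `(u, v)` is a critical pair of `P`. -/
def IsCriticalPair {α : Type*} (P : PartialOrder α) (u v : α) : Prop :=
  ¬ P.le u v ∧ ¬ P.le v u ∧ (∀ z, P.lt z u → P.lt z v) ∧ (∀ z, P.lt v z → P.lt u z)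

/-- `L` reverses some critical pair of `P`. -/
def Reverses {α : Type*} (P : PartialOrder α) (L : LinearOrder α) : Prop :=
  ∃ u v : α, IsCriticalPair P u v ∧ L.lt v u

/-- `P` is diametrally reversing: every diametral linear extension reverses a critical pair. -/
def DiametrallyReversing {α : Type*} (P : PartialOrder α) : Prop :=
  ∀ L : LinearOrder α, IsDiametral P L → Reverses P L

/-- `M` is a module of `P`. -/
def IsModuleOf {α : Type*} (P : PartialOrder α) (M : Set α) : Prop :=
  ∀ x, x ∉ M →
    (∀ m ∈ M, P.lt x m) ∨ (∀ m ∈ M, P.lt m x) ∨ (∀ m ∈ M, ¬ P.le x m ∧ ¬ P.le m x)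

/-- `P` is a chain: any two elements are comparable. -/
def IsChainOrder {α : Type*} (P : PartialOrder α) : Prop :=
  ∀ x y : α, P.le x y ∨ P.le y x

/-- `M` is an interval of the linear order `L`. -/
def IsIntervalOf {α : Type*} (L : LinearOrder α) (M : Set α) : Prop :=
  ∀ a ∈ M, ∀ c ∈ M, ∀ b : α, L.lt a b → L.lt b c → b ∈ M

open Classical in
/-- The order obtained from `L` by gathering `M` into one block at the position of `m`. -/
@[reducible]
noncomputable def blockOrder {α : Type*} (L : LinearOrder α) (M : Set α) (m : α) :
    LinearOrder α :=
  letI := L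
  LinearOrder.lift' (fun x : α => toLex (if x ∈ M then m else x, x))
    (fun _ _ h => congrArg (fun p => (ofLex p).2) h)

open Classical in
theorem blockOrder_lt {α : Type*} (L : LinearOrder α) (M : Set α) (m x y : α) :
    (blockOrder L M m).lt x y ↔
      L.lt (if x ∈ M then m else x) (if y ∈ M then m else y) ∨
        (if x ∈ M then m else x) = (if y ∈ M then m else y) ∧ L.lt x y := by
  let := L
  exact Prod.Lex.toLex_lt_toLex
    (x := (if x ∈ M then m else x, x)) (y := (if y ∈ M then m else y, y))

section

variable {α : Type*} (L : LinearOrder α) {M : Set α} {m x y : α}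

theorem blockOrder_lt_of_mem_of_mem (hx : x ∈ M) (hy : y ∈ M) :
    (blockOrder L M m).lt x y ↔ L.lt x y := by
  rw [blockOrder_lt, if_pos hx, if_pos hy]
  have : ¬ L.lt m m := @lt_irrefl α L.toPreorder m
  tauto

theorem blockOrder_lt_of_notMem_of_notMem (hx : x ∉ M) (hy : y ∉ M) :
    (blockOrder L M m).lt x y ↔ L.lt x y := by
  rw [blockOrder_lt, if_neg hx, if_neg hy]
  tauto

theorem blockOrder_lt_of_mem_of_notMem (hm : m ∈ M) (hx : x ∈ M) (hy : y ∉ M) :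
    (blockOrder L M m).lt x y ↔ L.lt m y := by
  rw [blockOrder_lt, if_pos hx, if_neg hy]
  have : m ≠ y := fun h => hy (h ▸ hm)
  tauto

theorem blockOrder_lt_of_notMem_of_mem (hm : m ∈ M) (hx : x ∉ M) (hy : y ∈ M) :
    (blockOrder L M m).lt x y ↔ L.lt x m := by
  rw [blockOrder_lt, if_neg hx, if_pos hy]
  have : x ≠ m := fun h => hx (h ▸ hm)
  tauto

theorem isIntervalOf_blockOrder (hm : m ∈ M) : IsIntervalOf (blockOrder L M m) M := by
  intro a ha c hc b hab hbc
  by_contra hb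
  rw [blockOrder_lt_of_mem_of_notMem L hm ha hb] at hab
  rw [blockOrder_lt_of_notMem_of_mem L hm hb hc] at hbc
  exact @lt_asymm α L.toPreorder _ _ hab hbc

end

theorem isLinExt_iff_lt {α : Type*} {P : PartialOrder α} {L : LinearOrder α} :
    IsLinExt P L ↔ ∀ x y, P.lt x y → L.lt x y := by
  constructor
  · intro h x y hxy
    refine @lt_of_le_of_ne α L.toPartialOrder x y (h x y (@le_of_lt α P.toPreorder x y hxy)) ?_
    exact @ne_of_lt α P.toPreorder x y hxy
  · intro h x y hxy
    rcases @eq_or_lt_of_le α P x y hxy with rfl | hlt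
    · exact L.le_refl x
    · exact @le_of_lt α L.toPreorder x y (h x y hlt)

theorem exists_isLinExt {α : Type*} (P : PartialOrder α) : ∃ L : LinearOrder α, IsLinExt P L :=
  ⟨(inferInstance : LinearOrder (LinearExtension α)), fun _ _ h => toLinearExtension.monotone h⟩

theorem IsModuleOf.lt_left {α : Type*} {P : PartialOrder α} {M : Set α} (hM : IsModuleOf P M)
    {x y m : α} (hx : x ∉ M) (hy : y ∈ M) (hm : m ∈ M) (h : P.lt x y) : P.lt x m := by
  rcases hM x hx with h' | h' | h'
  · exact h' m hm
  · exact absurd h (@lt_asymm α P.toPreorder _ _ (h' y hy))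
  · exact absurd (@le_of_lt α P.toPreorder x y h) (h' y hy).1

theorem IsModuleOf.lt_right {α : Type*} {P : PartialOrder α} {M : Set α} (hM : IsModuleOf P M)
    {x y m : α} (hx : x ∈ M) (hy : y ∉ M) (hm : m ∈ M) (h : P.lt x y) : P.lt m y := by
  rcases hM y hy with h' | h' | h'
  · exact absurd h (@lt_asymm α P.toPreorder _ _ (h' x hx))
  · exact h' m hm
  · exact absurd (@le_of_lt α P.toPreorder x y h) (h' x hx).2

theorem IsLinExt.blockOrder {α : Type*} {P : PartialOrder α} {L : LinearOrder α} {M : Set α}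
    {m : α} (hL : IsLinExt P L) (hM : IsModuleOf P M) (hm : m ∈ M) :
    IsLinExt P (blockOrder L M m) := by
  rw [isLinExt_iff_lt] at hL ⊢
  intro x y hxy
  by_cases hx : x ∈ M <;> by_cases hy : y ∈ M
  · exact (blockOrder_lt_of_mem_of_mem L hx hy).2 (hL x y hxy)
  · exact (blockOrder_lt_of_mem_of_notMem L hm hx hy).2 (hL m y (hM.lt_right hx hy hm hxy))
  · exact (blockOrder_lt_of_notMem_of_mem L hm hx hy).2 (hL x m (hM.lt_left hx hy hm hxy))
  · exact (blockOrder_lt_of_notMem_of_notMem L hx hy).2 (hL x y hxy)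

section

variable {α : Type*} [Fintype α]

open Classical in
/-- The number of elements outside `M` whose position relative to `x` differs in the two orders. -/
noncomputable def crossInversions (L₁ L₂ : LinearOrder α) (M : Set α) (x : α) : ℕ :=
  ∑ y ∈ Finset.univ.filter (· ∉ M),
    ((if L₁.lt x y ∧ L₂.lt y x then 1 else 0) + (if L₁.lt y x ∧ L₂.lt x y then 1 else 0))

open Classical in
theorem leDist_eq_sum (L₁ L₂ : LinearOrder α) :
    leDist L₁ L₂ = ∑ x, ∑ y, if L₁.lt x y ∧ L₂.lt y x then 1 else 0 := by
  rw [leDist, Set.ncard_eq_toFinset_card', Set.toFinset_ofPred, Finset.card_filter,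
    Fintype.sum_prod_type]

open Classical in
theorem leDist_eq_add_sum_crossInversions (L₁ L₂ : LinearOrder α) (M : Set α) :
    leDist L₁ L₂ =
      (∑ x ∈ Finset.univ.filter (· ∈ M), ∑ y ∈ Finset.univ.filter (· ∈ M),
        if L₁.lt x y ∧ L₂.lt y x then 1 else 0) +
      (∑ x ∈ Finset.univ.filter (· ∉ M), ∑ y ∈ Finset.univ.filter (· ∉ M),
        if L₁.lt x y ∧ L₂.lt y x then 1 else 0) +
      ∑ x ∈ Finset.univ.filter (· ∈ M), crossInversions L₁ L₂ M x := by
  have split (f : α → ℕ) : ∑ x, f x =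
      ∑ x ∈ Finset.univ.filter (· ∈ M), f x + ∑ x ∈ Finset.univ.filter (· ∉ M), f x :=
    (Finset.sum_filter_add_sum_filter_not _ _ _).symm
  simp only [leDist_eq_sum, crossInversions, split, Finset.sum_add_distrib]
  rw [Finset.sum_comm (s := Finset.univ.filter (· ∉ M)) (t := Finset.univ.filter (· ∈ M))]
  ring

open Classical in
theorem crossInversions_blockOrder (L₁ L₂ : LinearOrder α) {M : Set α} {m x : α} (hm : m ∈ M)
    (hx : x ∈ M) :
    crossInversions (blockOrder L₁ M m) (blockOrder L₂ M m) M x = crossInversions L₁ L₂ M m := by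
  unfold crossInversions
  refine Finset.sum_congr rfl fun y hy => ?_
  have hy : y ∉ M := (Finset.mem_filter.1 hy).2
  simp only [blockOrder_lt_of_mem_of_notMem _ hm hx hy, blockOrder_lt_of_notMem_of_mem _ hm hy hx]

theorem exists_leDist_le_leDist_blockOrder (L₁ L₂ : LinearOrder α) {M : Set α}
    (hM : M.Nonempty) :
    ∃ m ∈ M, leDist L₁ L₂ ≤ leDist (blockOrder L₁ M m) (blockOrder L₂ M m) := by
  classical
  have hne : (Finset.univ.filter (· ∈ M)).Nonempty :=
    hM.imp fun x hx => Finset.mem_filter.2 ⟨Finset.mem_univ x, hx⟩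
  obtain ⟨m, hm, hmax⟩ := Finset.exists_max_image _ (crossInversions L₁ L₂ M) hne
  have hmM : m ∈ M := (Finset.mem_filter.1 hm).2
  refine ⟨m, hmM, ?_⟩
  rw [leDist_eq_add_sum_crossInversions L₁ L₂ M,
    leDist_eq_add_sum_crossInversions (blockOrder L₁ M m) (blockOrder L₂ M m) M]
  refine Nat.add_le_add (Nat.add_le_add (le_of_eq ?_) (le_of_eq ?_)) ?_
  · refine Finset.sum_congr rfl fun x hx => Finset.sum_congr rfl fun y hy => ?_
    have hx := (Finset.mem_filter.1 hx).2
    have hy := (Finset.mem_filter.1 hy).2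
    simp only [blockOrder_lt_of_mem_of_mem _ hx hy, blockOrder_lt_of_mem_of_mem _ hy hx]
  · refine Finset.sum_congr rfl fun x hx => Finset.sum_congr rfl fun y hy => ?_
    have hx := (Finset.mem_filter.1 hx).2
    have hy := (Finset.mem_filter.1 hy).2
    simp only [blockOrder_lt_of_notMem_of_notMem _ hx hy,
      blockOrder_lt_of_notMem_of_notMem _ hy hx]
  · refine Finset.sum_le_sum fun x hx => ?_
    rw [crossInversions_blockOrder L₁ L₂ hmM (Finset.mem_filter.1 hx).2]
    exact hmax x hx

theorem exists_isDiametralPair (P : PartialOrder α) :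
    ∃ L₁ L₂ : LinearOrder α, IsDiametralPair P L₁ L₂ := by
  obtain ⟨L, hL⟩ := exists_isLinExt P
  let S := {d : ℕ | ∃ L₁ L₂ : LinearOrder α, IsLinExt P L₁ ∧ IsLinExt P L₂ ∧ leDist L₁ L₂ = d}
  have hbdd : BddAbove S := by
    refine ⟨Nat.card (α × α), ?_⟩
    rintro _ ⟨L₁, L₂, -, -, rfl⟩
    exact Set.ncard_le_card _
  obtain ⟨L₁, L₂, h₁, h₂, heq⟩ := Nat.sSup_mem (s := S) ⟨_, L, L, hL, hL, rfl⟩ hbdd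
  exact ⟨L₁, L₂, h₁, h₂, fun M₁ M₂ hM₁ hM₂ =>
    (le_csSup hbdd ⟨M₁, M₂, hM₁, hM₂, rfl⟩).trans_eq heq.symm⟩

end

/-- For every partial order on a finite type and every module `M`, there is a diametral
pair of linear extensions in each of which the elements of `M` occur consecutively. -/
theorem statement_0 {α : Type*} [Fintype α] (P : PartialOrder α) (M : Set α)
    (hM : IsModuleOf P M) :
    ∃ L₁ L₂ : LinearOrder α, IsDiametralPair P L₁ L₂ ∧
      IsIntervalOf L₁ M ∧ IsIntervalOf L₂ M := by
  obtain ⟨L₁, L₂, h₁, h₂, hmax⟩ := exists_isDiametralPair P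
  rcases M.eq_empty_or_nonempty with rfl | hne
  · exact ⟨L₁, L₂, ⟨h₁, h₂, hmax⟩, fun _ h => h.elim, fun _ h => h.elim⟩
  obtain ⟨m, hm, hle⟩ := exists_leDist_le_leDist_blockOrder L₁ L₂ hne
  exact ⟨blockOrder L₁ M m, blockOrder L₂ M m,
    ⟨h₁.blockOrder hM hm, h₂.blockOrder hM hm,
      fun M₁ M₂ hM₁ hM₂ => (hmax M₁ M₂ hM₁ hM₂).trans hle⟩,
    isIntervalOf_blockOrder L₁ hm, isIntervalOf_blockOrder L₂ hm⟩
end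

section
/- Let n ≥ 2 and let 𝒮 be a set of subsets of Fin n (elements of Finset (Fin n)) that contains every singleton {i} and every complement of a singleton {i}ᶜ, for i : Fin n. Let P be the partial order induced on 𝒮 by set inclusion. Then the critical pairs of P are exactly the pairs ({i}, {i}ᶜ) for i : Fin n. -/
/-- The partial order induced on a subset `M`. -/
def inducedOrder {α : Type*} (P : PartialOrder α) (M : Set α) : PartialOrder M :=
  letI := P
  PartialOrder.lift (fun a : M => (a : α)) Subtype.val_injective

theorem isCriticalPair_inducedOrder_iff {n : ℕ} {S : Set (Finset (Fin n))} {u v : S} :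
    IsCriticalPair (inducedOrder inferInstance S) u v ↔
      ¬ u.1 ⊆ v.1 ∧ ¬ v.1 ⊆ u.1 ∧ (∀ z ∈ S, z ⊂ u.1 → z ⊂ v.1) ∧
        (∀ z ∈ S, v.1 ⊂ z → u.1 ⊂ z) :=
  ⟨fun ⟨h₁, h₂, h₃, h₄⟩ => ⟨h₁, h₂, fun z hz => h₃ ⟨z, hz⟩, fun z hz => h₄ ⟨z, hz⟩⟩,
    fun ⟨h₁, h₂, h₃, h₄⟩ => ⟨h₁, h₂, fun z => h₃ z.1 z.2, fun z => h₄ z.1 z.2⟩⟩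

/-- If a family of subsets of `Fin n` (`n ≥ 2`) contains all singletons and all their
complements, then the critical pairs of the induced inclusion order are exactly the
pairs `({i}, {i}ᶜ)`. -/
theorem statement_2 (n : ℕ) (hn : 2 ≤ n) (S : Set (Finset (Fin n)))
    (hsing : ∀ i : Fin n, ({i} : Finset (Fin n)) ∈ S)
    (hco : ∀ i : Fin n, ({i}ᶜ : Finset (Fin n)) ∈ S) (u v : S) :
    IsCriticalPair (inducedOrder inferInstance S) u v ↔
      ∃ i : Fin n, (u : Finset (Fin n)) = {i} ∧ (v : Finset (Fin n)) = {i}ᶜ := by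
  rw [isCriticalPair_inducedOrder_iff]
  constructor
  · rintro ⟨huv, -, hdown, hup⟩
    obtain ⟨i, hiu, hiv⟩ := Finset.not_subset.mp huv
    have hu : u.1 = {i} := by
      by_contra hne
      have hlt : {i} ⊂ u.1 :=
        (Finset.singleton_subset_iff.mpr hiu).ssubset_of_ne (Ne.symm hne)
      exact hiv (Finset.singleton_subset_iff.mp (hdown _ (hsing i) hlt).subset)
    refine ⟨i, hu, ?_⟩
    by_contra hne
    have hlt : v.1 ⊂ {i}ᶜ :=
      (Finset.subset_compl_singleton.mpr hiv).ssubset_of_ne hne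
    simpa using (hup _ (hco i) hlt).subset hiu
  · rintro ⟨i, hu, hv⟩
    have : Nontrivial (Fin n) := Fin.nontrivial_iff_two_le.mpr hn
    obtain ⟨j, hji⟩ := exists_ne i
    rw [hu, hv]
    refine ⟨by simp, fun h => hji (by simpa using h (show j ∈ {i}ᶜ by simpa using hji)), ?_, ?_⟩
    · intro z _ hz
      rw [Finset.ssubset_singleton_iff.mp hz, Finset.empty_ssubset]
      exact ⟨j, by simpa using hji⟩
    · intro z _ hz
      obtain ⟨k, hkz, hk⟩ := Finset.exists_of_ssubset hz
      obtain rfl : k = i := by simpa using hk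
      refine Finset.ssubset_iff_subset_ne.mpr ⟨Finset.singleton_subset_iff.mpr hkz, ?_⟩
      rintro rfl
      exact hji (by simpa using hz.subset (show j ∈ {k}ᶜ by simpa using hji))
end

section
/- There exists a partial order P on a finite type that is not a chain, such that for every diametral pair (L₁, L₂) of linear extensions of P, neither L₁ nor L₂ reverses any critical pair of P. -/
namespace DiametralExample

open Sum

section Averaging

variable {ι : Type*} [Fintype ι] [DecidableEq ι] {β : ι → Type*} [∀ i, Fintype (β i)]

/-- Resampling one coordinate of a choice function does not change averages. -/
theorem sum_sum_update (q : ι) (G : (∀ i, β i) → ℕ) :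
    ∑ f, ∑ i : β q, G (Function.update f q i) = Fintype.card (β q) * ∑ f, G f := by
  have hinv : Function.Involutive
      (fun p : (∀ i, β i) × β q => (Function.update p.1 q p.2, p.1 q)) := by
    intro p
    simp
  calc ∑ f, ∑ i : β q, G (Function.update f q i)
      = ∑ p : (∀ i, β i) × β q, G (hinv.toPerm _ p).1 := by
        rw [Fintype.sum_prod_type]
        rfl
    _ = ∑ p : (∀ i, β i) × β q, G p.1 :=
        Equiv.sum_comp hinv.toPerm (fun p : (∀ i, β i) × β q => G p.1)
    _ = Fintype.card (β q) * ∑ f, G f := by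
        rw [Fintype.sum_prod_type, Finset.mul_sum]
        simp

theorem sum_apply_pair {q r : ι} (hqr : q ≠ r) (g : β q → β r → ℕ) :
    ∑ f : ∀ i, β i, Fintype.card (β q) * Fintype.card (β r) * g (f q) (f r) =
      Fintype.card (∀ i, β i) * ∑ i, ∑ j, g i j := by
  have h1 := sum_sum_update (β := β) q (fun f => g (f q) (f r))
  have h2 := sum_sum_update (β := β) r (fun f => ∑ i, g i (f r))
  simp only [Function.update_self, Function.update_of_ne hqr.symm] at h1 h2
  rw [← Finset.mul_sum, mul_comm (Fintype.card (β q)), mul_assoc, ← h1, ← h2, Finset.sum_const,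
    Finset.sum_comm (f := fun i j => g i j), smul_eq_mul, Finset.card_univ]

/-- A sum over pairs of elements from different fibres, computed by averaging over all ways to
choose one representative in each fibre. -/
theorem sum_choice_eq (g : (Σ i, β i) → (Σ i, β i) → ℕ) (hg : ∀ q i j, g ⟨q, i⟩ ⟨q, j⟩ = 0) :
    ∑ f : ∀ i, β i, ∑ q, ∑ r,
        Fintype.card (β q) * Fintype.card (β r) * g ⟨q, f q⟩ ⟨r, f r⟩ =
      Fintype.card (∀ i, β i) * ∑ x, ∑ y, g x y := by
  rw [Finset.sum_comm, Fintype.sum_sigma, Finset.mul_sum]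
  refine Finset.sum_congr rfl fun q _ => ?_
  simp_rw [Fintype.sum_sigma]
  rw [Finset.sum_comm, Finset.sum_comm (s := (Finset.univ : Finset (β q))), Finset.mul_sum]
  refine Finset.sum_congr rfl fun r _ => ?_
  by_cases hqr : q = r
  · subst hqr
    simp [hg]
  · exact sum_apply_pair hqr fun i j => g ⟨q, i⟩ ⟨r, j⟩

open Classical in
theorem sum_choice_eq_mul_leDist (L₁ L₂ : LinearOrder (Σ i, β i))
    (h : ∀ q i j, L₁.lt ⟨q, i⟩ ⟨q, j⟩ → ¬ L₂.lt ⟨q, j⟩ ⟨q, i⟩) :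
    ∑ f : ∀ i, β i, ∑ q, ∑ r,
        (if L₁.lt ⟨q, f q⟩ ⟨r, f r⟩ ∧ L₂.lt ⟨r, f r⟩ ⟨q, f q⟩ then
          Fintype.card (β q) * Fintype.card (β r) else 0) =
      Fintype.card (∀ i, β i) * leDist L₁ L₂ := by
  have hsum : leDist L₁ L₂ = ∑ x, ∑ y, if L₁.lt x y ∧ L₂.lt y x then 1 else 0 := by
    rw [leDist, Set.ncard_eq_toFinset_card', ← Fintype.sum_prod_type', Finset.sum_boole]
    simp
  rw [hsum, ← sum_choice_eq _ fun q i j => if_neg fun hij => h q i j hij.1 hij.2]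
  simp only [mul_ite, mul_one, mul_zero]

end Averaging

/-- The weights of the nine heavy elements, up to a common factor. -/
def heavyWeight : Fin 9 → ℕ := ![4, 13, 1, 6, 13, 1, 4, 3, 6]

/-- The positions of the heavy elements in the second linear order of a realizer; their
positions in the first one are given by the order of `Fin 9`. -/
def heavyPos : Equiv.Perm (Fin 9) where
  toFun := ![7, 3, 8, 5, 1, 6, 0, 4, 2]
  invFun := ![6, 4, 8, 1, 7, 3, 5, 0, 2]
  left_inv := by decide
  right_inv := by decide

/-- The heavy elements below a given light element. -/
def down : Fin 10 → List (Fin 9) :=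
  ![[], [], [], [], [], [0, 1, 2, 4], [0, 1, 6], [0, 1, 2, 6], [0, 4, 6, 8], [1, 3, 4, 6, 8]]

/-- The heavy elements above a given light element. -/
def up : Fin 10 → List (Fin 9) :=
  ![[0, 2, 5, 7], [0, 2, 3, 5, 8], [2, 4, 5, 7, 8], [0, 2, 6, 7, 8], [3, 5, 6, 7, 8],
    [], [], [], [], []]

/-- The strict order of the weighted poset; heavy elements are `inl h`, light ones `inr t`. -/
def below : Fin 9 ⊕ Fin 10 → Fin 9 ⊕ Fin 10 → Bool
  | inl h, inl k => h < k && heavyPos h < heavyPos k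
  | inl h, inr t => (down t).contains h
  | inr t, inl h => (up t).contains h
  | inr s, inr t => (up s).any (fun h => (down t).contains h) || (s == 6 && t == 7)

/-- The size of the chain that replaces an element. -/
def wt : Fin 9 ⊕ Fin 10 → ℕ
  | inl h => 1000 * heavyWeight h
  | inr _ => 1

/-- The gap, among the heavy elements, where a light element sits in the first linear order. -/
def gap₁ : Fin 10 → Fin 10 := ![0, 0, 2, 0, 3, 5, 7, 7, 9, 9]

/-- The gap, among the heavy elements, where a light element sits in the second linear order. -/
def gap₂ : Fin 10 → Fin 10 := ![4, 2, 1, 0, 0, 9, 8, 9, 8, 6]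

/-- Position in the first of the two explicit diametral linear extensions. -/
def pos₁ : Fin 9 ⊕ Fin 10 → ℕ
  | inl h => ![3, 4, 6, 8, 9, 11, 12, 15, 16] h
  | inr t => ![0, 1, 5, 2, 7, 10, 13, 14, 17, 18] t

/-- Position in the second of the two explicit diametral linear extensions. -/
def pos₂ : Fin 9 ⊕ Fin 10 → ℕ
  | inl h => ![13, 7, 16, 10, 4, 12, 2, 9, 6] h
  | inr t => ![8, 5, 3, 1, 0, 18, 15, 17, 14, 11] t

/-- The pairs `x, y` with `x` before `y` in every optimal first linear order because of the
positions relative to the heavy elements. -/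
def forced₁ : Fin 9 ⊕ Fin 10 → Fin 9 ⊕ Fin 10 → Bool
  | inl h, inl k => h < k
  | inl h, inr t => h.castSucc < gap₁ t
  | inr t, inl h => gap₁ t ≤ h.castSucc
  | inr s, inr t => gap₁ s < gap₁ t

/-- The analogue of `forced₁` for the second linear order. -/
def forced₂ : Fin 9 ⊕ Fin 10 → Fin 9 ⊕ Fin 10 → Bool
  | inl h, inl k => heavyPos h < heavyPos k
  | inl h, inr t => (heavyPos h).castSucc < gap₂ t
  | inr t, inl h => gap₂ t ≤ (heavyPos h).castSucc
  | inr s, inr t => gap₂ s < gap₂ t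

/-- Incomparability in the weighted poset. -/
def incomp (x y : Fin 9 ⊕ Fin 10) : Bool := decide (x ≠ y) && !below x y && !below y x

/-- The pairs that are not forced to appear in the same order in an optimal pair. -/
def reversible (x y : Fin 9 ⊕ Fin 10) : Bool :=
  incomp x y && !(forced₁ x y && forced₂ x y) && !(forced₁ y x && forced₂ y x)

/-- Critical pairs of the weighted poset. -/
def critical (x y : Fin 9 ⊕ Fin 10) : Prop :=
  incomp x y ∧ (∀ z, below z x → below z y) ∧ ∀ z, below y z → below x z

instance : DecidableRel critical := fun _ _ => inferInstanceAs (Decidable (_ ∧ _))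

/-- The maximal weighted distance. -/
def maxDist : ℕ :=
  ∑ x, ∑ y, if pos₁ x < pos₁ y ∧ pos₂ y < pos₂ x then wt x * wt y else 0

theorem below_irrefl : ∀ x, below x x = false := by decide +kernel

theorem below_trans : ∀ x y z, below x y → below y z → below x z := by decide +kernel

theorem pos₁_injective : Function.Injective pos₁ := by
  have : ∀ x y, pos₁ x = pos₁ y → x = y := by decide +kernel
  exact fun x y => this x y

theorem pos₂_injective : Function.Injective pos₂ := by
  have : ∀ x y, pos₂ x = pos₂ y → x = y := by decide +kernel
  exact fun x y => this x y

theorem pos₁_lt : ∀ x y, below x y → pos₁ x < pos₁ y := by decide +kernel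

theorem pos₂_lt : ∀ x y, below x y → pos₂ x < pos₂ y := by decide +kernel

theorem forced_of_critical : ∀ x y, critical x y → forced₁ x y ∧ forced₂ x y := by
  decide +kernel

/-- The largest reversible weight between a light element and the heavy elements, up to a common
factor. -/
def best : Fin 10 → ℕ := ![36, 17, 21, 0, 18, 14, 10, 9, 1, 6]

theorem sum_reversed_le : ∀ (t : Fin 10) (i j : Fin 10),
    (∀ h : Fin 9, (below (inl h) (inr t) → h.castSucc < i ∧ (heavyPos h).castSucc < j) ∧
      (below (inr t) (inl h) → i ≤ h.castSucc ∧ j ≤ (heavyPos h).castSucc)) →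
    (∑ h : Fin 9, if (h.castSucc < i ∧ j ≤ (heavyPos h).castSucc) ∨
        (i ≤ h.castSucc ∧ (heavyPos h).castSucc < j) then heavyWeight h else 0) +
      (if i = gap₁ t ∧ j = gap₂ t then 0 else 1) ≤ best t := by
  decide +kernel

theorem two_mul_maxDist :
    2 * maxDist = (∑ h, ∑ k, if incomp (inl h) (inl k) then wt (inl h) * wt (inl k) else 0) +
      2 * (1000 * ∑ t, best t) + ∑ s, ∑ t, if reversible (inr s) (inr t) then 1 else 0 := by
  decide +kernel

theorem sum_incomp_lt :
    (∑ x, ∑ y, if incomp x y then wt x * wt y else 0) < 2 * maxDist + 1000000 := by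
  decide +kernel

/-- A strict total order extending `below`. -/
structure IsTotalExt (a : Fin 9 ⊕ Fin 10 → Fin 9 ⊕ Fin 10 → Prop) : Prop where
  asymm : ∀ x y, a x y → ¬ a y x
  trans : ∀ x y z, a x y → a y z → a x z
  total : ∀ x y, x ≠ y → a x y ∨ a y x
  of_below : ∀ x y, below x y → a x y

section WeightedDistance

open Classical in
/-- The weighted distance of two relations. -/
noncomputable def dist (a b : Fin 9 ⊕ Fin 10 → Fin 9 ⊕ Fin 10 → Prop) : ℕ :=
  ∑ x, ∑ y, if a x y ∧ b y x then wt x * wt y else 0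

/-- The pair `x, y` appears in different orders in `a` and `b`. -/
def Rev (a b : Fin 9 ⊕ Fin 10 → Fin 9 ⊕ Fin 10 → Prop) (x y : Fin 9 ⊕ Fin 10) : Prop :=
  (a x y ∧ b y x) ∨ (a y x ∧ b x y)

variable {a b : Fin 9 ⊕ Fin 10 → Fin 9 ⊕ Fin 10 → Prop}

theorem Rev.symm {x y : Fin 9 ⊕ Fin 10} (h : Rev a b x y) : Rev a b y x := Or.symm h

open Classical in
theorem dist_comm (a b : Fin 9 ⊕ Fin 10 → Fin 9 ⊕ Fin 10 → Prop) : dist a b = dist b a := by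
  unfold dist
  rw [Finset.sum_comm]
  refine Finset.sum_congr rfl fun x _ => Finset.sum_congr rfl fun y _ => ?_
  exact if_congr and_comm (mul_comm _ _) rfl

open Classical in
theorem two_mul_dist (ha : IsTotalExt a) :
    2 * dist a b = ∑ x, ∑ y, if Rev a b x y then wt x * wt y else 0 := by
  have h : dist a b = ∑ x, ∑ y, if a y x ∧ b x y then wt x * wt y else 0 := by
    rw [dist, Finset.sum_comm]
    refine Finset.sum_congr rfl fun x _ => Finset.sum_congr rfl fun y _ => ?_
    rw [mul_comm]
  rw [two_mul]
  nth_rewrite 2 [h]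
  rw [dist, ← Finset.sum_add_distrib]
  refine Finset.sum_congr rfl fun x _ => ?_
  rw [← Finset.sum_add_distrib]
  refine Finset.sum_congr rfl fun y _ => ?_
  have := ha.asymm x y
  unfold Rev
  by_cases h1 : a x y <;> by_cases h2 : a y x <;> by_cases h3 : b x y <;> by_cases h4 : b y x <;>
    simp_all

theorem Rev.incomp (ha : IsTotalExt a) (hb : IsTotalExt b) {x y : Fin 9 ⊕ Fin 10}
    (h : Rev a b x y) : incomp x y := by
  have hne : x ≠ y := by
    rintro rfl
    rcases h with h | h <;> exact ha.asymm _ _ h.1 h.1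
  have h1 : below x y = false := by
    by_contra hxy
    have hxy : below x y := by simpa using hxy
    rcases h with h | h
    · exact hb.asymm _ _ h.2 (hb.of_below _ _ hxy)
    · exact ha.asymm _ _ h.1 (ha.of_below _ _ hxy)
  have h2 : below y x = false := by
    by_contra hxy
    have hxy : below y x := by simpa using hxy
    rcases h with h | h
    · exact ha.asymm _ _ h.1 (ha.of_below _ _ hxy)
    · exact hb.asymm _ _ h.2 (hb.of_below _ _ hxy)
  simp [DiametralExample.incomp, hne, h1, h2]

/-- If some incomparable pair of heavy elements is not reversed, the distance is not maximal. -/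
theorem dist_lt_of_not_rev (ha : IsTotalExt a) (hb : IsTotalExt b) {h k : Fin 9}
    (hi : incomp (inl h) (inl k)) (hr : ¬ Rev a b (inl h) (inl k)) : dist a b < maxDist := by
  classical
  have key : (∑ x, ∑ y, if Rev a b x y then wt x * wt y else 0) + wt (inl h) * wt (inl k) ≤
      ∑ x, ∑ y, if incomp x y then wt x * wt y else 0 := by
    have hs : wt (inl h) * wt (inl k) =
        ∑ x, ∑ y, if x = inl h ∧ y = inl k then wt x * wt y else 0 := by
      rw [Finset.sum_eq_single (inl h), Finset.sum_eq_single (inl k)]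
      · simp
      · intro y _ hy
        simp [hy]
      · simp
      · intro x _ hx
        simp [hx]
      · simp
    rw [hs, ← Finset.sum_add_distrib]
    refine Finset.sum_le_sum fun x _ => ?_
    rw [← Finset.sum_add_distrib]
    refine Finset.sum_le_sum fun y _ => ?_
    by_cases hxy : x = inl h ∧ y = inl k
    · obtain ⟨rfl, rfl⟩ := hxy
      simp [hr, hi]
    · by_cases hR : Rev a b x y
      · simp [hxy, hR, hR.incomp ha hb]
      · simp [hxy, hR]
  have hw : ∀ h k : Fin 9, 1000000 ≤ wt (inl h) * wt (inl k) := by decide +kernel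
  have h1 := two_mul_dist (b := b) ha
  have h2 := sum_incomp_lt
  have h3 := hw h k
  omega

/-- If all incomparable pairs of heavy elements are reversed, the order of one such pair determines
the order of all of them. -/
theorem heavy_order (ha : IsTotalExt a) (hb : IsTotalExt b)
    (hr : ∀ h k : Fin 9, incomp (inl h) (inl k) → Rev a b (inl h) (inl k))
    (h01 : a (inl 0) (inl 1) ∧ b (inl 1) (inl 0)) (h k : Fin 9) (hhk : h < k)
    (hi : incomp (inl h) (inl k)) : a (inl h) (inl k) ∧ b (inl k) (inl h) := by
  have stepL : ∀ i j k : Fin 9, below (inl i) (inl k) ∨ below (inl k) (inl i) →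
      incomp (inl k) (inl j) → (a (inl i) (inl j) ∧ b (inl j) (inl i)) →
      a (inl k) (inl j) ∧ b (inl j) (inl k) := by
    intro i j k hik hkj ⟨h1, h2⟩
    rcases hr k j hkj with h | ⟨h3, h4⟩
    · exact h
    · rcases hik with hik | hik
      · exact absurd (hb.trans _ _ _ (hb.of_below _ _ hik) h4) (hb.asymm _ _ h2)
      · exact absurd (ha.trans _ _ _ h3 (ha.of_below _ _ hik)) (ha.asymm _ _ h1)
  have stepR : ∀ i j k : Fin 9, below (inl j) (inl k) ∨ below (inl k) (inl j) →
      incomp (inl i) (inl k) → (a (inl i) (inl j) ∧ b (inl j) (inl i)) →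
      a (inl i) (inl k) ∧ b (inl k) (inl i) := by
    intro i j k hjk hik ⟨h1, h2⟩
    rcases hr i k hik with h | ⟨h3, h4⟩
    · exact h
    · rcases hjk with hjk | hjk
      · exact absurd (ha.trans _ _ _ (ha.of_below _ _ hjk) h3) (ha.asymm _ _ h1)
      · exact absurd (hb.trans _ _ _ h4 (hb.of_below _ _ hjk)) (hb.asymm _ _ h2)
  have h03 := stepR 0 1 3 (by decide) (by decide) h01
  have h05 := stepR 0 1 5 (by decide) (by decide) h01
  have h07 := stepR 0 1 7 (by decide) (by decide) h01
  have h23 := stepL 0 3 2 (by decide) (by decide) h03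
  have h25 := stepL 0 5 2 (by decide) (by decide) h05
  have h04 := stepR 0 5 4 (by decide) (by decide) h05
  have h27 := stepL 0 7 2 (by decide) (by decide) h07
  have h06 := stepR 0 7 6 (by decide) (by decide) h07
  have h24 := stepR 2 5 4 (by decide) (by decide) h25
  have h08 := stepR 0 4 8 (by decide) (by decide) h04
  have h26 := stepR 2 7 6 (by decide) (by decide) h27
  have h14 := stepL 2 4 1 (by decide) (by decide) h24
  have h28 := stepR 2 4 8 (by decide) (by decide) h24
  have h16 := stepL 2 6 1 (by decide) (by decide) h26
  have h34 := stepL 1 4 3 (by decide) (by decide) h14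
  have h18 := stepR 1 4 8 (by decide) (by decide) h14
  have h36 := stepL 1 6 3 (by decide) (by decide) h16
  have h56 := stepL 1 6 5 (by decide) (by decide) h16
  have h37 := stepR 3 4 7 (by decide) (by decide) h34
  have h38 := stepR 3 4 8 (by decide) (by decide) h34
  have h58 := stepL 1 8 5 (by decide) (by decide) h18
  have h78 := stepL 1 8 7 (by decide) (by decide) h18
  have h46 := stepL 5 6 4 (by decide) (by decide) h56
  have h57 := stepR 5 6 7 (by decide) (by decide) h56
  fin_cases h <;> fin_cases k <;> first | assumption | exact absurd hhk (by decide) |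
    exact absurd hi (by decide)

/-- A decreasing predicate on `Fin n` is an initial segment. -/
theorem exists_forall_iff_castSucc_lt {n : ℕ} (p : Fin n → Prop)
    (hp : ∀ h k, h < k → p k → p h) : ∃ i : Fin (n + 1), ∀ h, p h ↔ h.castSucc < i := by
  classical
  by_cases hall : ∀ h, p h
  · exact ⟨Fin.last n, fun h => ⟨fun _ => Fin.castSucc_lt_last h, fun _ => hall h⟩⟩
  · push Not at hall
    obtain ⟨m, hm, hmin⟩ := wellFounded_lt.has_min {h | ¬ p h} hall
    refine ⟨m.castSucc, fun h => ?_⟩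
    rw [Fin.castSucc_lt_castSucc_iff]
    constructor
    · intro hph
      by_contra hlt
      rcases lt_or_eq_of_le (not_lt.mp hlt) with h1 | h1
      · exact hm (hp _ _ h1 hph)
      · exact hm (h1 ▸ hph)
    · intro hlt
      by_contra hph
      exact hmin h hph hlt

theorem le_of_parts {d m hh hh' hl e hl' ll ll' : ℕ}
    (hd : 2 * d = hh + 1000 * hl + (1000 * hl + ll))
    (hm : 2 * m = hh' + 2 * (1000 * hl') + ll') (h₁ : hh ≤ hh') (h₂ : hl + e ≤ hl')
    (h₃ : ll ≤ ll') : d ≤ m := by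
  omega

theorem lt_of_parts {d m hh hh' hl e hl' ll ll' : ℕ}
    (hd : 2 * d = hh + 1000 * hl + (1000 * hl + ll))
    (hm : 2 * m = hh' + 2 * (1000 * hl') + ll') (h₁ : hh ≤ hh') (h₂ : hl + e ≤ hl') (he : 1 ≤ e)
    (h₃ : ll ≤ 100) : d < m := by
  omega

theorem dist_le_aux (ha : IsTotalExt a) (hb : IsTotalExt b)
    (hr : ∀ h k : Fin 9, incomp (inl h) (inl k) → Rev a b (inl h) (inl k))
    (h01 : a (inl 0) (inl 1) ∧ b (inl 1) (inl 0)) :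
    dist a b ≤ maxDist ∧
      (dist a b = maxDist → ∀ x y, critical x y → a x y ∧ b x y) := by
  classical
  have order := heavy_order ha hb hr h01
  have hcmp : ∀ h k : Fin 9, h < k → incomp (inl h) (inl k) ∧ heavyPos k < heavyPos h ∨
      below (inl h) (inl k) ∧ heavyPos h < heavyPos k := by decide
  have a_heavy : ∀ h k : Fin 9, h < k → a (inl h) (inl k) := fun h k hhk => by
    rcases hcmp h k hhk with h1 | h1
    · exact (order h k hhk h1.1).1
    · exact ha.of_below _ _ h1.1
  have b_heavy : ∀ h k : Fin 9, heavyPos h < heavyPos k → b (inl h) (inl k) := fun h k hp => by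
    rcases lt_trichotomy h k with hhk | rfl | hhk
    · rcases hcmp h k hhk with h1 | h1
      · exact absurd hp h1.2.asymm
      · exact hb.of_below _ _ h1.1
    · exact absurd hp (lt_irrefl _)
    · rcases hcmp k h hhk with h1 | h1
      · exact (order k h hhk h1.1).2
      · exact absurd hp h1.2.asymm
  have hi : ∀ t : Fin 10, ∃ i : Fin 10, ∀ h : Fin 9, a (inl h) (inr t) ↔ h.castSucc < i :=
    fun t => exists_forall_iff_castSucc_lt _ fun h k hhk hk =>
      ha.trans _ _ _ (a_heavy h k hhk) hk
  have hj : ∀ t : Fin 10, ∃ j : Fin 10, ∀ h : Fin 9,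
      b (inl h) (inr t) ↔ (heavyPos h).castSucc < j := fun t => by
    obtain ⟨j, hj⟩ := exists_forall_iff_castSucc_lt
      (fun h : Fin 9 => b (inl (heavyPos.symm h)) (inr t)) fun h k hhk hk =>
        hb.trans _ _ _ (b_heavy _ _ (by simpa using hhk)) hk
    exact ⟨j, fun h => by simpa using hj (heavyPos h)⟩
  choose i hi using hi
  choose j hj using hj
  have flip : ∀ {c : Fin 9 ⊕ Fin 10 → Fin 9 ⊕ Fin 10 → Prop}, IsTotalExt c →
      ∀ (h : Fin 9) (t : Fin 10), c (inr t) (inl h) ↔ ¬ c (inl h) (inr t) := fun hc h t =>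
    ⟨hc.asymm _ _, fun hn => (hc.total _ _ (by simp)).resolve_right hn⟩
  have hi' : ∀ (h : Fin 9) t, a (inr t) (inl h) ↔ i t ≤ h.castSucc := fun h t => by
    rw [flip ha, hi, not_lt]
  have hj' : ∀ (h : Fin 9) t, b (inr t) (inl h) ↔ j t ≤ (heavyPos h).castSucc := fun h t => by
    rw [flip hb, hj, not_lt]
  have hsum := fun t => sum_reversed_le t (i t) (j t) fun h =>
    ⟨fun hb' => ⟨(hi t h).1 (ha.of_below _ _ hb'), (hj t h).1 (hb.of_below _ _ hb')⟩,
      fun hb' => ⟨(hi' h t).1 (ha.of_below _ _ hb'), (hj' h t).1 (hb.of_below _ _ hb')⟩⟩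
  have hRev : ∀ (h : Fin 9) t, ((h.castSucc < i t ∧ j t ≤ (heavyPos h).castSucc) ∨
      (i t ≤ h.castSucc ∧ (heavyPos h).castSucc < j t)) ↔ Rev a b (inl h) (inr t) := fun h t => by
    simp only [Rev, hi, hi', hj, hj']
  simp only [hRev] at hsum
  have hsum' := Finset.sum_le_sum fun t (_ : t ∈ Finset.univ) => hsum t
  rw [Finset.sum_add_distrib] at hsum'
  have hd := two_mul_dist (b := b) ha
  simp only [Fintype.sum_sum_type, Finset.sum_add_distrib] at hd
  have hHH : (∑ h, ∑ k, if Rev a b (inl h) (inl k) then wt (inl h) * wt (inl k) else 0) ≤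
      ∑ h, ∑ k, if incomp (inl h) (inl k) then wt (inl h) * wt (inl k) else 0 := by
    refine Finset.sum_le_sum fun h _ => Finset.sum_le_sum fun k _ => ?_
    by_cases hR : Rev a b (inl h) (inl k)
    · simp [hR, hR.incomp ha hb]
    · simp [hR]
  have hHL : (∑ h, ∑ t, if Rev a b (inl h) (inr t) then wt (inl h) * wt (inr t) else 0) =
      1000 * ∑ t, ∑ h, if Rev a b (inl h) (inr t) then heavyWeight h else 0 := by
    rw [Finset.sum_comm, Finset.mul_sum]
    refine Finset.sum_congr rfl fun t _ => ?_
    rw [Finset.mul_sum]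
    refine Finset.sum_congr rfl fun h _ => ?_
    simp [wt]
  have hLH : (∑ t, ∑ h, if Rev a b (inr t) (inl h) then wt (inr t) * wt (inl h) else 0) =
      1000 * ∑ t, ∑ h, if Rev a b (inl h) (inr t) then heavyWeight h else 0 := by
    rw [← hHL, Finset.sum_comm]
    refine Finset.sum_congr rfl fun h _ => Finset.sum_congr rfl fun t _ => ?_
    exact if_congr ⟨Rev.symm, Rev.symm⟩ (mul_comm _ _) rfl
  rw [hHL, hLH] at hd
  by_cases hcell : ∀ t, i t = gap₁ t ∧ j t = gap₂ t
  · have hf₁ : ∀ x y, forced₁ x y → a x y := by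
      rintro (h | s) (k | t) hf <;> simp only [forced₁, decide_eq_true_eq] at hf
      · exact a_heavy h k hf
      · exact (hi t h).2 ((hcell t).1 ▸ hf)
      · exact (hi' k s).2 ((hcell s).1 ▸ hf)
      · have hlt : (gap₁ s).val < 9 := by omega
        refine ha.trans _ (inl ⟨gap₁ s, hlt⟩) _ ((hi' _ s).2 ?_) ((hi t _).2 ?_)
        · rw [(hcell s).1]; exact le_rfl
        · rw [(hcell t).1]; exact hf
    have hf₂ : ∀ x y, forced₂ x y → b x y := by
      rintro (h | s) (k | t) hf <;> simp only [forced₂, decide_eq_true_eq] at hf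
      · exact b_heavy h k hf
      · exact (hj t h).2 ((hcell t).2 ▸ hf)
      · exact (hj' k s).2 ((hcell s).2 ▸ hf)
      · have hlt : (gap₂ s).val < 9 := by omega
        refine hb.trans _ (inl (heavyPos.symm ⟨gap₂ s, hlt⟩)) _ ((hj' _ s).2 ?_) ((hj t _).2 ?_)
        · rw [(hcell s).2, Equiv.apply_symm_apply]; exact le_rfl
        · rw [(hcell t).2, Equiv.apply_symm_apply]; exact hf
    have hLL : (∑ s, ∑ t, if Rev a b (inr s) (inr t) then wt (inr s) * wt (inr t) else 0) ≤
        ∑ s, ∑ t, if reversible (inr s) (inr t) then 1 else 0 := by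
      refine Finset.sum_le_sum fun s _ => Finset.sum_le_sum fun t _ => ?_
      by_cases hR : Rev a b (inr s) (inr t)
      · have hrv : reversible (inr s) (inr t) := by
          have h1 : ¬ (forced₁ (inr s) (inr t) ∧ forced₂ (inr s) (inr t)) := fun hf => by
            rcases hR with h | h
            · exact hb.asymm _ _ h.2 (hf₂ _ _ hf.2)
            · exact ha.asymm _ _ h.1 (hf₁ _ _ hf.1)
          have h2 : ¬ (forced₁ (inr t) (inr s) ∧ forced₂ (inr t) (inr s)) := fun hf => by
            rcases hR with h | h
            · exact ha.asymm _ _ h.1 (hf₁ _ _ hf.1)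
            · exact hb.asymm _ _ h.2 (hf₂ _ _ hf.2)
          rw [← Bool.and_eq_true] at h1 h2
          simp only [reversible, hR.incomp ha hb, Bool.true_and, Bool.and_eq_true,
            Bool.not_eq_true', Bool.eq_false_iff]
          exact ⟨h1, h2⟩
        simp [hR, hrv, wt]
      · simp [hR]
    refine ⟨le_of_parts hd two_mul_maxDist hHH hsum' hLL, fun _ x y hxy => ?_⟩
    have hf := forced_of_critical x y hxy
    exact ⟨hf₁ _ _ hf.1, hf₂ _ _ hf.2⟩
  · push Not at hcell
    obtain ⟨t, ht⟩ := hcell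
    have herr : 1 ≤ ∑ t, if i t = gap₁ t ∧ j t = gap₂ t then 0 else 1 := by
      refine le_trans ?_ (Finset.single_le_sum (fun _ _ => Nat.zero_le _) (Finset.mem_univ t))
      rw [if_neg fun h => ht h.1 h.2]
    have hLL : (∑ s : Fin 10, ∑ t : Fin 10,
        if Rev a b (inr s) (inr t) then wt (inr s) * wt (inr t) else 0) ≤
        100 := by
      refine le_trans (b := ∑ s : Fin 10, ∑ t : Fin 10, 1) ?_ (by simp)
      refine Finset.sum_le_sum fun s _ => Finset.sum_le_sum fun t _ => ?_
      split_ifs <;> simp [wt]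
    have hlt : dist a b < maxDist := lt_of_parts hd two_mul_maxDist hHH hsum' herr hLL
    exact ⟨hlt.le, fun h => absurd h hlt.ne⟩

/-- The weighted distance is at most `maxDist`, and no critical pair is reversed if it is
attained. -/
theorem dist_le (ha : IsTotalExt a) (hb : IsTotalExt b) :
    dist a b ≤ maxDist ∧
      (dist a b = maxDist → ∀ x y, critical x y → a x y ∧ b x y) := by
  by_cases hr : ∀ h k : Fin 9, incomp (inl h) (inl k) → Rev a b (inl h) (inl k)
  · rcases hr 0 1 (by decide) with h01 | h01
    · exact dist_le_aux ha hb hr h01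
    · have h := dist_le_aux hb ha (fun h k hi => (hr h k hi).imp And.symm And.symm |>.symm) h01.symm
      rw [dist_comm] at h
      exact ⟨h.1, fun he x y hxy => (h.2 he x y hxy).symm⟩
  · push Not at hr
    obtain ⟨h, k, hi, hR⟩ := hr
    have hlt := dist_lt_of_not_rev ha hb hi hR
    exact ⟨hlt.le, fun he => absurd he hlt.ne⟩

end WeightedDistance

/-- The elements of the example: each element of the weighted poset becomes a chain. -/
def Elt : Type := Σ q : Fin 9 ⊕ Fin 10, Fin (wt q)

instance : Fintype Elt := inferInstanceAs (Fintype (Σ q : Fin 9 ⊕ Fin 10, Fin (wt q)))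

/-- The partial order of the example. -/
@[reducible] def order : PartialOrder Elt where
  le x y := below x.1 y.1 ∨ x.1 = y.1 ∧ x.2.val ≤ y.2.val
  le_refl x := Or.inr ⟨rfl, le_rfl⟩
  le_trans := by
    rintro ⟨x, i⟩ ⟨y, j⟩ ⟨z, k⟩ (hxy | ⟨rfl, hij⟩) (hyz | ⟨rfl, hjk⟩)
    · exact Or.inl (below_trans _ _ _ hxy hyz)
    · exact Or.inl hxy
    · exact Or.inl hyz
    · exact Or.inr ⟨rfl, hij.trans hjk⟩
  le_antisymm := by
    rintro ⟨x, i⟩ ⟨y, j⟩ (hxy | ⟨rfl, hij⟩) (hyx | ⟨hyx, hji⟩)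
    · simpa [below_irrefl] using below_trans _ _ _ hxy hyx
    · dsimp only at hyx hxy
      simp [hyx, below_irrefl] at hxy
    · simp [below_irrefl] at hyx
    · exact congrArg _ (Fin.ext (hij.antisymm hji))

theorem order_le {x y : Elt} : order.le x y ↔ below x.1 y.1 ∨ x.1 = y.1 ∧ x.2.val ≤ y.2.val :=
  Iff.rfl

theorem order_lt_of_below {x y : Elt} (h : below x.1 y.1) : order.lt x y := by
  refine (order.lt_iff_le_not_ge x y).2 ⟨Or.inl h, ?_⟩
  rintro (h' | h')
  · simpa [below_irrefl] using below_trans _ _ _ h h'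
  · simp [h'.1, below_irrefl] at h

theorem below_of_order_lt {x y : Elt} (h : order.lt x y) (hne : x.1 ≠ y.1) :
    below x.1 y.1 := by
  rcases ((order.lt_iff_le_not_ge x y).1 h).1 with h | h
  · exact h
  · exact absurd h.1 hne

theorem wt_pos : ∀ q, 0 < wt q := by decide +kernel

/-- A critical pair of the example lies over a critical pair of the weighted poset. -/
theorem critical_of_isCriticalPair {x y : Elt} (h : IsCriticalPair order x y) :
    critical x.1 y.1 := by
  obtain ⟨h1, h2, h3, h4⟩ := h
  rw [order_le, not_or] at h1 h2
  have hne : x.1 ≠ y.1 := fun he => by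
    rcases le_total x.2.val y.2.val with hle | hle
    · exact h1.2 ⟨he, hle⟩
    · exact h2.2 ⟨he.symm, hle⟩
  refine ⟨?_, fun z hz => ?_, fun z hz => ?_⟩
  · simp [incomp, hne, h1.1, h2.1]
  · refine below_of_order_lt (h3 ⟨z, ⟨0, wt_pos z⟩⟩ (order_lt_of_below hz)) fun he => h2.1 ?_
    exact (show z = y.1 from he) ▸ hz
  · refine below_of_order_lt (h4 ⟨z, ⟨0, wt_pos z⟩⟩ (order_lt_of_below hz)) fun he => h2.1 ?_
    exact (show x.1 = z from he) ▸ hz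

/-- A function bounded by `m` is constant if its average is at least that of the constant
function `m`. -/
theorem eq_of_average_le {ι : Type*} [Fintype ι] {g g' : ι → ℕ} {m d d' : ℕ} (hg : ∀ i, g i ≤ m)
    (hg' : ∀ i, g' i = m) (h : ∑ i, g i = Fintype.card ι * d)
    (h' : ∑ i, g' i = Fintype.card ι * d') (hd : d' ≤ d) (i : ι) : g i = m := by
  refine (Finset.sum_eq_sum_iff_of_le fun i _ => hg i).1 (le_antisymm
    (Finset.sum_le_sum fun i _ => hg i) ?_) i (Finset.mem_univ i)
  rw [h, ← Finset.sum_congr rfl fun i _ => hg' i, h']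
  exact Nat.mul_le_mul_left _ hd

/-- The element of the chain over `x` chosen by `f`. -/
def rep (f : ∀ q, Fin (wt q)) (x : Fin 9 ⊕ Fin 10) : Elt := ⟨x, f x⟩

/-- The relation on the weighted poset obtained by choosing one representative of each chain. -/
def restrict (L : LinearOrder Elt) (f : ∀ q, Fin (wt q)) (x y : Fin 9 ⊕ Fin 10) : Prop :=
  L.lt (rep f x) (rep f y)

theorem lt_of_isLinExt {L : LinearOrder Elt} (hL : IsLinExt order L) {x y : Elt}
    (h : order.le x y) (hne : x ≠ y) : L.lt x y :=
  let _ := L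
  lt_of_le_of_ne (hL x y h) hne

theorem restrict_isTotalExt {L : LinearOrder Elt} (hL : IsLinExt order L)
    (f : ∀ q, Fin (wt q)) : IsTotalExt (restrict L f) where
  asymm x y h := @lt_asymm Elt _ (rep f x) (rep f y) h
  trans x y z h h' := @lt_trans Elt _ (rep f x) (rep f y) (rep f z) h h'
  total x y hne := @lt_or_gt_of_ne Elt _ (rep f x) (rep f y) fun h => hne (congrArg Sigma.fst h)
  of_below x y h := lt_of_isLinExt hL (Or.inl h) fun he => by
    have he' : x = y := congrArg Sigma.fst he
    rw [he'] at h
    simp [below_irrefl] at h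

/-- Linear extensions agree on each chain. -/
theorem not_lt_of_fst_eq {L₁ L₂ : LinearOrder Elt} (h₁ : IsLinExt order L₁)
    (h₂ : IsLinExt order L₂) {x y : Elt} (hxy : x.1 = y.1) (h : L₁.lt x y) : ¬ L₂.lt y x := by
  have hne : x ≠ y := fun he => @lt_irrefl Elt L₁.toPreorder x (he.symm ▸ h)
  rcases le_total x.2.val y.2.val with hle | hle
  · exact @lt_asymm Elt L₂.toPreorder x y (lt_of_isLinExt h₂ (Or.inr ⟨hxy, hle⟩) hne)
  · exact absurd (lt_of_isLinExt h₁ (Or.inr ⟨hxy.symm, hle⟩) hne.symm)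
      (@lt_asymm Elt L₁.toPreorder x y h)

/-- The distance of two linear extensions is the average of the weighted distances of their
restrictions. -/
theorem sum_dist_restrict {L₁ L₂ : LinearOrder Elt} (h₁ : IsLinExt order L₁)
    (h₂ : IsLinExt order L₂) :
    ∑ f, dist (restrict L₁ f) (restrict L₂ f) =
      Fintype.card (∀ q, Fin (wt q)) * leDist L₁ L₂ := by
  classical
  have key := sum_choice_eq_mul_leDist (β := fun q => Fin (wt q)) L₁ L₂ fun q i j =>
    not_lt_of_fst_eq h₁ h₂ (x := ⟨q, i⟩) (y := ⟨q, j⟩) rfl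
  refine Eq.trans ?_ key
  refine Finset.sum_congr rfl fun f _ => Finset.sum_congr rfl fun x _ =>
    Finset.sum_congr rfl fun y _ => ?_
  rw [Fintype.card_fin, Fintype.card_fin]
  by_cases hxy : restrict L₁ f x y ∧ restrict L₂ f y x
  · exact (if_pos hxy).trans (if_pos hxy).symm
  · exact (if_neg hxy).trans (if_neg hxy).symm

theorem wt_le : ∀ q, wt q ≤ 13000 := by decide +kernel

/-- The linear order on the example that concatenates the chains in the order given by `pos`. -/
@[reducible] def concat (pos : Fin 9 ⊕ Fin 10 → ℕ) (hpos : Function.Injective pos) :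
    LinearOrder Elt :=
  LinearOrder.lift' (fun x : Elt => pos x.1 * 13000 + x.2.val) <| by
    rintro ⟨x, i⟩ ⟨y, j⟩ h
    have hi := i.isLt.trans_le (wt_le x)
    have hj := j.isLt.trans_le (wt_le y)
    dsimp only at h
    obtain rfl : x = y := hpos (by omega)
    exact congrArg _ (Fin.ext (by omega))

theorem concat_lt {pos : Fin 9 ⊕ Fin 10 → ℕ} (hpos : Function.Injective pos) {x y : Elt}
    (hne : x.1 ≠ y.1) : (concat pos hpos).lt x y ↔ pos x.1 < pos y.1 := by
  have hi := x.2.isLt.trans_le (wt_le x.1)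
  have hj := y.2.isLt.trans_le (wt_le y.1)
  have hp := hpos.ne hne
  change pos x.1 * 13000 + x.2.val < pos y.1 * 13000 + y.2.val ↔ _
  omega

theorem concat_isLinExt {pos : Fin 9 ⊕ Fin 10 → ℕ} (hpos : Function.Injective pos)
    (hlt : ∀ x y, below x y → pos x < pos y) : IsLinExt order (concat pos hpos) := by
  rintro ⟨x, i⟩ ⟨y, j⟩ h
  change pos x * 13000 + i.val ≤ pos y * 13000 + j.val
  have hi := i.isLt.trans_le (wt_le x)
  rcases h with h | ⟨h, hij⟩
  · have := hlt x y h
    omega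
  · dsimp only at h hij
    subst h
    omega

theorem dist_restrict_concat (f : ∀ q, Fin (wt q)) :
    dist (restrict (concat pos₁ pos₁_injective) f) (restrict (concat pos₂ pos₂_injective) f) =
      maxDist := by
  classical
  refine Finset.sum_congr rfl fun x _ => Finset.sum_congr rfl fun y _ => ?_
  refine if_congr ?_ rfl rfl
  by_cases hxy : x = y
  · subst hxy
    exact ⟨fun h => absurd h.1 (@lt_irrefl Elt (concat pos₁ pos₁_injective).toPreorder (rep f x)),
      fun h => absurd h.1 (lt_irrefl _)⟩
  · exact and_congr (concat_lt pos₁_injective hxy) (concat_lt pos₂_injective (Ne.symm hxy))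

/-- In a diametral pair, every choice of representatives attains the maximal weighted distance. -/
theorem dist_restrict_of_isDiametralPair {L₁ L₂ : LinearOrder Elt}
    (h : IsDiametralPair order L₁ L₂) (f : ∀ q, Fin (wt q)) :
    dist (restrict L₁ f) (restrict L₂ f) = maxDist := by
  obtain ⟨h₁, h₂, hmax⟩ := h
  have e₁ := concat_isLinExt pos₁_injective pos₁_lt
  have e₂ := concat_isLinExt pos₂_injective pos₂_lt
  exact eq_of_average_le
    (fun f => (dist_le (restrict_isTotalExt h₁ f) (restrict_isTotalExt h₂ f)).1)
    dist_restrict_concat (sum_dist_restrict h₁ h₂) (sum_dist_restrict e₁ e₂) (hmax _ _ e₁ e₂) f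

/-- Both linear extensions of a diametral pair put a critical pair in the unreversed order. -/
theorem lt_of_isCriticalPair {L₁ L₂ : LinearOrder Elt} (h : IsDiametralPair order L₁ L₂)
    {x y : Elt} (hxy : IsCriticalPair order x y) : L₁.lt x y ∧ L₂.lt x y := by
  have hc := critical_of_isCriticalPair hxy
  have hne : x.1 ≠ y.1 := fun he => by
    have := hc.1
    simp [incomp, he] at this
  let f : ∀ q, Fin (wt q) := Function.update (Function.update (fun q => ⟨0, wt_pos q⟩) x.1 x.2)
    y.1 y.2
  have hx : rep f x.1 = x := by
    simp only [rep, f, Function.update_of_ne hne, Function.update_self]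
    rfl
  have hy : rep f y.1 = y := by
    simp only [rep, f, Function.update_self]
    rfl
  have key := (dist_le (restrict_isTotalExt h.1 f) (restrict_isTotalExt h.2.1 f)).2
    (dist_restrict_of_isDiametralPair h f) _ _ hc
  simpa only [restrict, hx, hy] using key

end DiametralExample

/-- There is a finite poset, not a chain, such that in every diametral pair of linear
extensions neither linear extension reverses any critical pair. -/
theorem statement_4 :
    ∃ (α : Type) (_ : Fintype α) (P : PartialOrder α),
      ¬ IsChainOrder P ∧
        ∀ L₁ L₂ : LinearOrder α, IsDiametralPair P L₁ L₂ →
          ¬ Reverses P L₁ ∧ ¬ Reverses P L₂ := by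
  refine ⟨DiametralExample.Elt, inferInstance, DiametralExample.order, fun hchain => ?_,
    fun L₁ L₂ h => ⟨?_, ?_⟩⟩
  · have hc := hchain ⟨Sum.inl 0, ⟨0, DiametralExample.wt_pos _⟩⟩
      ⟨Sum.inl 1, ⟨0, DiametralExample.wt_pos _⟩⟩
    exact absurd (hc.imp DiametralExample.order_le.1 DiametralExample.order_le.1) (by decide)
  · rintro ⟨u, v, huv, hlt⟩
    exact (let _ := L₁; lt_asymm hlt) (DiametralExample.lt_of_isCriticalPair h huv).1
  · rintro ⟨u, v, huv, hlt⟩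
    exact (let _ := L₂; lt_asymm hlt) (DiametralExample.lt_of_isCriticalPair h huv).2
end

section
/- Let P be a partial order on a finite type that is not a chain, and suppose P has order dimension 2, i.e., there exist two linear extensions M₁, M₂ of P such that for all x, y: x ≤ y in P if and only if x ≤ y in M₁ and x ≤ y in M₂. Then P is diametrally reversing. -/
/-- The pairs `(x, y)`, in either order, on which two linear orders disagree. -/
def reversedPairs {α : Type*} (L₁ L₂ : LinearOrder α) : Set (α × α) :=
  {p | L₁.lt p.1 p.2 ∧ L₂.lt p.2 p.1} ∪ Prod.swap '' {p | L₁.lt p.1 p.2 ∧ L₂.lt p.2 p.1}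

theorem mem_reversedPairs {α : Type*} {L₁ L₂ : LinearOrder α} {x y : α} :
    (x, y) ∈ reversedPairs L₁ L₂ ↔
      (L₁.lt x y ∧ L₂.lt y x) ∨ (L₁.lt y x ∧ L₂.lt x y) := by
  simp [reversedPairs]

theorem ncard_reversedPairs {α : Type*} [Finite α] (L₁ L₂ : LinearOrder α) :
    (reversedPairs L₁ L₂).ncard = 2 * leDist L₁ L₂ := by
  rw [reversedPairs, Set.ncard_union_eq _ (Set.toFinite _) (Set.toFinite _),
    Set.ncard_image_of_injective _ Prod.swap_injective, leDist, two_mul]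
  rw [Set.disjoint_left]
  rintro ⟨x, y⟩ ⟨hxy, -⟩ ⟨⟨a, b⟩, ⟨hab, -⟩, heq⟩
  obtain ⟨rfl, rfl⟩ := Prod.mk.inj heq
  exact @lt_asymm α L₁.toPreorder _ _ hxy hab

theorem not_le_of_mem_reversedPairs {α : Type*} {P : PartialOrder α} {L₁ L₂ : LinearOrder α}
    (h₁ : IsLinExt P L₁) (h₂ : IsLinExt P L₂) {x y : α} (h : (x, y) ∈ reversedPairs L₁ L₂) :
    ¬ P.le x y ∧ ¬ P.le y x := by
  have n₁ := fun a b => @not_lt α L₁ a b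
  have n₂ := fun a b => @not_lt α L₂ a b
  rcases mem_reversedPairs.1 h with ⟨ha, hb⟩ | ⟨ha, hb⟩
  · exact ⟨fun hle => (n₂ y x).2 (h₂ _ _ hle) hb, fun hle => (n₁ x y).2 (h₁ _ _ hle) ha⟩
  · exact ⟨fun hle => (n₁ y x).2 (h₁ _ _ hle) ha, fun hle => (n₂ x y).2 (h₂ _ _ hle) hb⟩

theorem mem_reversedPairs_of_realizer {α : Type*} {P : PartialOrder α} {M₁ M₂ : LinearOrder α}
    (hreal : ∀ x y : α, P.le x y ↔ (M₁.le x y ∧ M₂.le x y)) {x y : α}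
    (hxy : ¬ P.le x y) (hyx : ¬ P.le y x) : (x, y) ∈ reversedPairs M₁ M₂ := by
  rw [mem_reversedPairs]
  have n₁ := fun a b => @not_le α M₁ a b
  have n₂ := fun a b => @not_le α M₂ a b
  have a₁ := @lt_asymm α M₁.toPreorder x y
  have a₂ := @lt_asymm α M₂.toPreorder x y
  rw [hreal, not_and_or, n₁, n₂] at hxy hyx
  tauto

/-- If `P` has a realizer of size two, every diametral pair reverses all incomparable pairs. -/
theorem IsDiametralPair.lt_of_incomparable {α : Type*} [Finite α] {P : PartialOrder α}
    {M₁ M₂ L L' : LinearOrder α} (h₁ : IsLinExt P M₁) (h₂ : IsLinExt P M₂)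
    (hreal : ∀ x y : α, P.le x y ↔ (M₁.le x y ∧ M₂.le x y)) (h : IsDiametralPair P L L')
    {x y : α} (hxy : ¬ P.le x y) (hyx : ¬ P.le y x) (hlt : L.lt x y) : L'.lt y x := by
  obtain ⟨hL, hL', hmax⟩ := h
  have hsub : reversedPairs L L' ⊆ reversedPairs M₁ M₂ := fun ⟨a, b⟩ hab =>
    have hinc := not_le_of_mem_reversedPairs hL hL' hab
    mem_reversedPairs_of_realizer hreal hinc.1 hinc.2
  have heq : reversedPairs L L' = reversedPairs M₁ M₂ := by
    refine Set.eq_of_subset_of_ncard_le hsub ?_ (Set.toFinite _)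
    rw [ncard_reversedPairs, ncard_reversedPairs]
    exact Nat.mul_le_mul_left 2 (hmax M₁ M₂ h₁ h₂)
  have hmem := mem_reversedPairs_of_realizer hreal hxy hyx
  rw [← heq, mem_reversedPairs] at hmem
  rcases hmem with hmem | hmem
  · exact hmem.2
  · exact absurd hlt (@lt_asymm α L.toPreorder _ _ hmem.1)

theorem leDist_comm {α : Type*} [Finite α] (L₁ L₂ : LinearOrder α) :
    leDist L₁ L₂ = leDist L₂ L₁ := by
  have h : reversedPairs L₁ L₂ = reversedPairs L₂ L₁ := by
    ext ⟨x, y⟩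
    rw [mem_reversedPairs, mem_reversedPairs]
    tauto
  have hcard := congrArg Set.ncard h
  rw [ncard_reversedPairs, ncard_reversedPairs] at hcard
  exact Nat.eq_of_mul_eq_mul_left two_pos hcard

theorem IsDiametralPair.symm {α : Type*} [Finite α] {P : PartialOrder α} {L L' : LinearOrder α}
    (h : IsDiametralPair P L L') : IsDiametralPair P L' L :=
  ⟨h.2.1, h.1, fun M₁ M₂ h₁ h₂ => leDist_comm L L' ▸ h.2.2 M₁ M₂ h₁ h₂⟩

/-- The first element of `L` incomparable to some earlier one is incomparable to its
immediate predecessor. -/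
theorem exists_incomparable_adjacent {α : Type*} [Finite α] {P : PartialOrder α}
    (hchain : ¬ IsChainOrder P) {L : LinearOrder α} (hL : IsLinExt P L) :
    ∃ u v : α, L.lt v u ∧ ¬ P.le u v ∧ ¬ P.le v u ∧ (∀ z, L.lt z u → L.le z v) ∧
      ∀ z, L.lt z v → P.le z v := by
  have irr : ∀ a, ¬ L.lt a a := @lt_irrefl α L.toPreorder
  have trans : ∀ a b c, L.lt a b → L.lt b c → L.lt a c := @lt_trans α L.toPreorder
  have tri : ∀ a b, L.lt a b ∨ a = b ∨ L.lt b a := @lt_trichotomy α L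
  have nle : ∀ a b, ¬ L.le a b ↔ L.lt b a := @not_le α L
  have nlt : ∀ a b, ¬ L.lt a b ↔ L.le b a := @not_lt α L
  have wf : WellFounded L.lt := (@Finite.to_wellFoundedLT α _ L.toPreorder).wf
  have wf' : WellFounded (fun a b => L.lt b a) := (@Finite.to_wellFoundedGT α _ L.toPreorder).wf
  have hne : {u | ∃ v, L.lt v u ∧ ¬ P.le u v ∧ ¬ P.le v u}.Nonempty := by
    simp only [IsChainOrder, not_forall, not_or] at hchain
    obtain ⟨x, y, hxy, hyx⟩ := hchain
    rcases tri x y with h | rfl | h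
    · exact ⟨y, x, h, hyx, hxy⟩
    · exact absurd (P.le_refl x) hxy
    · exact ⟨x, y, h, hxy, hyx⟩
  obtain ⟨u, hu, humin⟩ := wf.has_min _ hne
  have below : ∀ a b, L.lt b u → L.lt a b → P.le a b := by
    intro a b hbu hab
    by_contra hn
    exact humin b ⟨a, hab, fun hba => (nlt a b).2 (hL _ _ hba) hab, hn⟩ hbu
  obtain ⟨v, hv, hvmax⟩ := wf'.has_min {v | L.lt v u ∧ ¬ P.le u v ∧ ¬ P.le v u} hu
  refine ⟨u, v, hv.1, hv.2.1, hv.2.2, fun z hz => ?_, fun z hz => below z v hv.1 hz⟩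
  by_contra hzv
  rw [nle] at hzv
  refine hvmax z ⟨hz, fun huz => (nlt z u).2 (hL _ _ huz) hz, fun hzu => ?_⟩ hzv
  exact hv.2.2 (P.le_trans _ _ _ (below v z hz hzv) hzu)

/-- Every finite poset of order dimension 2 which is not a chain is diametrally
reversing. -/
theorem statement_5 {α : Type*} [Fintype α] (P : PartialOrder α)
    (hchain : ¬ IsChainOrder P) (M₁ M₂ : LinearOrder α)
    (h₁ : IsLinExt P M₁) (h₂ : IsLinExt P M₂)
    (hreal : ∀ x y : α, P.le x y ↔ (M₁.le x y ∧ M₂.le x y)) :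
    DiametrallyReversing P := by
  intro L hdiam
  obtain ⟨L', hpair⟩ : ∃ L', IsDiametralPair P L L' := by
    obtain ⟨L', h | h⟩ := hdiam
    exacts [⟨L', h⟩, ⟨L', h.symm⟩]
  have hL := hpair.1
  obtain ⟨u, v, hvu, huv', hvu', hadj, hbelow⟩ := exists_incomparable_adjacent hchain hL
  have hP : ∀ a b, P.lt a b ↔ P.le a b ∧ ¬ P.le b a := P.lt_iff_le_not_ge
  have hPlt : ∀ a b, P.le a b → a ≠ b → P.lt a b := fun a b => @lt_of_le_of_ne α P a b
  have hLlt : ∀ a b, P.le a b → a ≠ b → L.lt a b := fun a b h =>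
    @lt_of_le_of_ne α L.toPartialOrder a b (hL a b h)
  have hLle : ∀ a b, L.le a b → a ≠ b → L.lt a b := fun a b =>
    @lt_of_le_of_ne α L.toPartialOrder a b
  have hnlt : ∀ a b, ¬ L.lt a b ↔ L.le b a := @not_lt α L
  refine ⟨u, v, ⟨huv', hvu', fun z hz => ?_, fun z hz => ?_⟩, hvu⟩
  · rw [hP] at hz
    have hzu : z ≠ u := by rintro rfl; exact hz.2 hz.1
    have hzv : z ≠ v := by rintro rfl; exact hvu' hz.1
    exact hPlt z v (hbelow z (hLle z v (hadj z (hLlt z u hz.1 hzu)) hzv)) hzv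
  · rw [hP] at hz
    have hvz : v ≠ z := by rintro rfl; exact hz.2 hz.1
    have huz : u ≠ z := by rintro rfl; exact hvu' hz.1
    have hle : L.le u z := (hnlt z u).1 fun h => (hnlt v z).2 (hadj z h) (hLlt v z hz.1 hvz)
    refine hPlt u z (by_contra fun hn => ?_) huz
    have hzu : ¬ P.le z u := fun h => hvu' (P.le_trans _ _ _ hz.1 h)
    have hzu' : L'.lt z u := hpair.lt_of_incomparable h₁ h₂ hreal hn hzu (hLle u z hle huz)
    have huv : L'.lt u v := hpair.lt_of_incomparable h₁ h₂ hreal hvu' huv' hvu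
    exact (@not_lt α L' z v).2 (hpair.2.1 v z hz.1) (@lt_trans α L'.toPreorder _ _ _ hzu' huv)
end

section
/- Let P be a partial order on a finite type and M a module of P. Then every critical pair (u, v) of the partial order induced on M is also a critical pair of P. -/
/-- Critical pairs of the order induced on a module `M` of `P` are critical pairs
of `P`. -/
theorem statement_8 {α : Type*} [Fintype α] (P : PartialOrder α) (M : Set α)
    (hM : IsModuleOf P M) (u v : M)
    (h : IsCriticalPair (inducedOrder P M) u v) :
    IsCriticalPair P (u : α) (v : α) := by
  let := P
  obtain ⟨huv, hvu, hdown, hup⟩ := h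
  refine ⟨huv, hvu, fun z hz => ?_, fun z hz => ?_⟩
  · by_cases hzM : z ∈ M
    · exact hdown ⟨z, hzM⟩ hz
    · rcases hM z hzM with hbelow | habove | hinc
      · exact hbelow v v.2
      · exact absurd hz (lt_asymm (habove u u.2))
      · exact absurd (le_of_lt hz) (hinc u u.2).1
  · by_cases hzM : z ∈ M
    · exact hup ⟨z, hzM⟩ hz
    · rcases hM z hzM with hbelow | habove | hinc
      · exact absurd hz (lt_asymm (hbelow v v.2))
      · exact habove u u.2
      · exact absurd (le_of_lt hz) (hinc v v.2).2
end

section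
/- Every 3-layer poset that is not a chain is diametrally reversing. That is: let P be a partial order on a finite nonempty type such that every maximal chain of P has exactly 3 elements, every minimal element of P is strictly below every maximal element of P, and P is not a chain. Then P is diametrally reversing. -/
/-- The opposite of a partial order. -/
abbrev PartialOrder.opp {α : Type*} (P : PartialOrder α) : PartialOrder α :=
  inferInstanceAs (PartialOrder αᵒᵈ)

/-- The opposite of a linear order. -/
abbrev LinearOrder.opp {α : Type*} (L : LinearOrder α) : LinearOrder α :=
  inferInstanceAs (LinearOrder αᵒᵈ)

/-- A nonempty part of a finite partial order has a minimal element. -/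
theorem PartialOrder.exists_minimal_of_finite {α : Type*} [Finite α] (P : PartialOrder α)
    (p : α → Prop) (hp : ∃ x, p x) : ∃ m, p m ∧ ∀ z, p z → ¬ P.lt z m := by
  obtain ⟨m, hm⟩ := (Set.toFinite {x | p x}).exists_minimal hp
  exact ⟨m, hm.1, fun z hz => hm.not_lt hz⟩

/-- Refining the preorder given by an integer-valued rank by a linear order. -/
theorem exists_linearOrder_rank_lex {α : Type*} (k : α → ℤ) (K : LinearOrder α) :
    ∃ M : LinearOrder α, ∀ x y, M.lt x y ↔ k x < k y ∨ k x = k y ∧ K.lt x y := by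
  refine ⟨LinearOrder.lift' (fun x => toLex (k x, x)) fun x y h => congrArg (fun p => (ofLex p).2) h,
    fun x y => ?_⟩
  exact Prod.Lex.toLex_lt_toLex

/-- Refining the preorder given by an integer-valued rank by the reverse of a linear order. -/
theorem exists_linearOrder_rank_lex_opp {α : Type*} (k : α → ℤ) (K : LinearOrder α) :
    ∃ M : LinearOrder α, ∀ x y, M.lt x y ↔ k x < k y ∨ k x = k y ∧ K.lt y x :=
  exists_linearOrder_rank_lex k K.opp

/-- The two linear orders order `x` and `y` oppositely. -/
def OppositelyOrdered {α : Type*} (L₁ L₂ : LinearOrder α) (x y : α) : Prop :=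
  (L₁.lt x y ∧ L₂.lt y x) ∨ (L₁.lt y x ∧ L₂.lt x y)

theorem ncard_oppositelyOrdered {α : Type*} [Finite α] (L₁ L₂ : LinearOrder α) :
    {p : α × α | OppositelyOrdered L₁ L₂ p.1 p.2}.ncard = 2 * leDist L₁ L₂ := by
  have hswap : {p : α × α | L₁.lt p.2 p.1 ∧ L₂.lt p.1 p.2} =
      Prod.swap '' {p : α × α | L₁.lt p.1 p.2 ∧ L₂.lt p.2 p.1} := by
    rw [Set.image_swap_eq_preimage_swap]
    rfl
  have hunion : {p : α × α | OppositelyOrdered L₁ L₂ p.1 p.2} =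
      {p : α × α | L₁.lt p.1 p.2 ∧ L₂.lt p.2 p.1} ∪
        {p : α × α | L₁.lt p.2 p.1 ∧ L₂.lt p.1 p.2} := rfl
  rw [hunion, Set.ncard_union_eq, hswap, Set.ncard_image_of_injective _ Prod.swap_injective,
    leDist, two_mul]
  rw [Set.disjoint_left]
  rintro ⟨x, y⟩ ⟨h, -⟩ ⟨h', -⟩
  exact @lt_asymm _ L₁.toPreorder _ _ h h'

theorem leDist_lt_of_oppositelyOrdered {α : Type*} [Finite α] {L₁ L₂ M₁ M₂ : LinearOrder α}
    (h : ∀ x y, OppositelyOrdered L₁ L₂ x y → OppositelyOrdered M₁ M₂ x y) {u v : α}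
    (hL : ¬ OppositelyOrdered L₁ L₂ u v) (hM : OppositelyOrdered M₁ M₂ u v) :
    leDist L₁ L₂ < leDist M₁ M₂ := by
  have hss : {p : α × α | OppositelyOrdered L₁ L₂ p.1 p.2} ⊂
      {p : α × α | OppositelyOrdered M₁ M₂ p.1 p.2} :=
    (Set.ssubset_iff_of_subset fun p hp => h _ _ hp).2 ⟨(u, v), hM, hL⟩
  have := Set.ncard_lt_ncard hss
  rw [ncard_oppositelyOrdered, ncard_oppositelyOrdered] at this
  omega

/-- A rank function with values `-1`, `0`, `1` exhibiting a poset as a 3-layer poset. -/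
structure IsThreeLayerRank {α : Type*} (P : PartialOrder α) (r : α → ℤ) : Prop where
  range : ∀ x, r x = -1 ∨ r x = 0 ∨ r x = 1
  lt_of_lt : ∀ x y, P.lt x y → r x < r y
  bot_lt_top : ∀ x y, r x = -1 → r y = 1 → P.lt x y
  exists_between : ∀ x y, r x = -1 → r y = 1 → ∃ z, r z = 0 ∧ P.lt x z ∧ P.lt z y
  exists_bot : ∃ x, r x = -1
  exists_top : ∃ x, r x = 1

theorem IsThreeLayerRank.opp {α : Type*} {P : PartialOrder α} {r : α → ℤ}
    (h : IsThreeLayerRank P r) : IsThreeLayerRank P.opp (-r) where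
  range x := by have := h.range x; simp only [Pi.neg_apply]; omega
  lt_of_lt x y hxy := by have := h.lt_of_lt y x hxy; simp only [Pi.neg_apply]; omega
  bot_lt_top x y hx hy := by
    simp only [Pi.neg_apply] at hx hy
    exact h.bot_lt_top y x (by omega) (by omega)
  exists_between x y hx hy := by
    simp only [Pi.neg_apply] at hx hy
    obtain ⟨z, hz, h₁, h₂⟩ := h.exists_between y x (by omega) (by omega)
    exact ⟨z, by simp [hz], h₂, h₁⟩
  exists_bot := by
    obtain ⟨x, hx⟩ := h.exists_top
    exact ⟨x, by simp [hx]⟩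
  exists_top := by
    obtain ⟨x, hx⟩ := h.exists_bot
    exact ⟨x, by simp [hx]⟩

theorem exists_isThreeLayerRank {α : Type*} [Finite α] [Nonempty α] (P : PartialOrder α)
    (hmc : ∀ C : Set α, IsMaxChain P.le C → C.ncard = 3)
    (hmm : ∀ a c : α, (∀ z, ¬ P.lt z a) → (∀ z, ¬ P.lt c z) → P.lt a c) :
    ∃ r : α → ℤ, IsThreeLayerRank P r := by
  classical
  have hcard : ∀ C : Set α, IsChain P.le C → ∃ D, C ⊆ D ∧ IsChain P.le D ∧ D.ncard = 3 := by
    intro C hC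
    obtain ⟨D, hD, hCD⟩ := hC.exists_maxChain
    exact ⟨D, hCD, hD.1, hmc D hD⟩
  obtain ⟨a₀, -, ha₀⟩ := P.exists_minimal_of_finite (fun _ => True)
    ⟨Classical.arbitrary α, trivial⟩
  obtain ⟨c₀, -, hc₀⟩ := P.opp.exists_minimal_of_finite (fun _ => True)
    ⟨Classical.arbitrary α, trivial⟩
  simp only [forall_const] at ha₀
  replace hc₀ : ∀ z, ¬ P.lt c₀ z := fun z => hc₀ z trivial
  have hirr : ∀ x, ¬ P.lt x x := fun x => lt_irrefl x
  have htr : ∀ x y z, P.lt x y → P.lt y z → P.lt x z := fun x y z => lt_trans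
  have hle : ∀ x y, P.lt x y → P.le x y := fun x y => le_of_lt
  have hbetween : ∀ a c, (∀ z, ¬ P.lt z a) → (∀ z, ¬ P.lt c z) →
      ∃ b, P.lt a b ∧ P.lt b c := by
    intro a c ha hc
    have hac := hmm a c ha hc
    obtain ⟨D, hsub, hD, hn⟩ := hcard {a, c} (IsChain.pair (hle _ _ hac))
    have hlt : ({a, c} : Set α).ncard < D.ncard := by
      have := Set.ncard_insert_le a {c}
      rw [Set.ncard_singleton] at this
      omega
    obtain ⟨b, hbD, hb⟩ := Set.exists_mem_notMem_of_ncard_lt_ncard hlt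
    simp only [Set.mem_insert_iff, Set.mem_singleton_iff, not_or] at hb
    refine ⟨b, ?_, ?_⟩
    · rcases hD hbD (hsub (by simp : a ∈ ({a, c} : Set α))) hb.1 with h | h
      · exact absurd (lt_of_le_of_ne h hb.1) (ha b)
      · exact lt_of_le_of_ne h (Ne.symm hb.1)
    · rcases hD hbD (hsub (by simp : c ∈ ({a, c} : Set α))) hb.2 with h | h
      · exact lt_of_le_of_ne h hb.2
      · exact absurd (lt_of_le_of_ne h (Ne.symm hb.2)) (hc b)
  have hfour : ∀ w x y z, P.lt w x → P.lt x y → P.lt y z → False := by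
    intro w x y z hwx hxy hyz
    have hC : IsChain P.le {w, x, y, z} := by
      have hwy := htr _ _ _ hwx hxy
      have hwz := htr _ _ _ hwy hyz
      have hxz := htr _ _ _ hxy hyz
      rintro s hs t ht -
      simp only [Set.mem_insert_iff, Set.mem_singleton_iff] at hs ht
      have hrefl : ∀ x, P.le x x := fun x => le_refl x
      grind
    obtain ⟨D, hsub, -, hn⟩ := hcard _ hC
    have h4 : ({w, x, y, z} : Set α).ncard = 4 := by
      have hwy := htr _ _ _ hwx hxy
      have hwz := htr _ _ _ hwy hyz
      have hxz := htr _ _ _ hxy hyz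
      have hne : ∀ {s t}, P.lt s t → s ≠ t := fun h => ne_of_lt h
      have : ({w, x, y, z} : Set α) = (({w, x, y, z} : Finset α) : Set α) := by simp
      rw [this, Set.ncard_coe_finset]
      simp [hne hwx, hne hwy, hne hwz, hne hxy, hne hxz, hne hyz]
    have := Set.ncard_le_ncard hsub
    omega
  have hnot : ∀ x, (∀ z, ¬ P.lt z x) → (∀ z, ¬ P.lt x z) → False := fun x h₁ h₂ =>
    hirr x (hmm x x h₁ h₂)
  let r : α → ℤ := fun x => if ∀ z, ¬ P.lt z x then -1 else if ∀ z, ¬ P.lt x z then 1 else 0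
  have hbot : ∀ x, r x = -1 ↔ ∀ z, ¬ P.lt z x := by
    intro x; simp only [r]; split_ifs <;> simp_all
  have htop : ∀ x, r x = 1 ↔ ∀ z, ¬ P.lt x z := by
    intro x
    have := hnot x
    simp only [r]; split_ifs <;> grind
  have hrange : ∀ x, r x = -1 ∨ r x = 0 ∨ r x = 1 := by
    intro x; simp only [r]; split_ifs <;> simp
  refine ⟨r, hrange, ?_, fun x y hx hy => hmm x y ((hbot x).1 hx) ((htop y).1 hy), ?_,
    ⟨a₀, (hbot _).2 ha₀⟩, ⟨c₀, (htop _).2 hc₀⟩⟩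
  · intro x y hxy
    have hx : r x ≠ 1 := fun h => (htop x).1 h y hxy
    have hy : r y ≠ -1 := fun h => (hbot y).1 h x hxy
    have hxy0 : ¬ (r x = 0 ∧ r y = 0) := by
      rintro ⟨hx0, hy0⟩
      have h₁ : ¬ ∀ z, ¬ P.lt z x := by rw [← hbot]; omega
      have h₂ : ¬ ∀ z, ¬ P.lt y z := by rw [← htop]; omega
      push Not at h₁ h₂
      obtain ⟨w, hw⟩ := h₁
      obtain ⟨z, hz⟩ := h₂
      exact hfour w x y z hw hxy hz
    have := hrange x
    have := hrange y
    omega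
  · intro x y hx hy
    obtain ⟨b, h₁, h₂⟩ := hbetween x y ((hbot x).1 hx) ((htop y).1 hy)
    refine ⟨b, ?_, h₁, h₂⟩
    have hx : r b ≠ 1 := fun h => (htop b).1 h y h₂
    have hy : r b ≠ -1 := fun h => (hbot b).1 h x h₁
    have := hrange b
    omega

/-- If `a` is a minimal element lying below the whole middle layer in `L'` and incomparable to the
last middle element `b` of `L'`, then some pair of linear extensions reverses the pair `(a, b)`
in addition to all pairs that `L'` and a layer-by-layer linear extension can reverse. -/
theorem IsThreeLayerRank.exists_improvement {α : Type*} {P : PartialOrder α} {r : α → ℤ}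
    (hr : IsThreeLayerRank P r) {L' : LinearOrder α} (hL' : IsLinExt P L') {a b : α}
    (ha : r a = -1) (hb : r b = 0) (hab : ¬ P.lt a b) (hfirst : ∀ x, r x = 0 → L'.lt a x)
    (hlast : ∀ x, r x = 0 → x ≠ b → L'.lt x b) :
    ∃ M M' : LinearOrder α, IsLinExt P M ∧ IsLinExt P M' ∧
      (∀ x y, r x = r y → x ≠ y → OppositelyOrdered M M' x y) ∧
      (∀ x y, r x < r y → L'.lt y x → M.lt x y ∧ M'.lt y x) ∧ OppositelyOrdered M M' a b := by
  classical
  rw [isLinExt_iff_lt] at hL'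
  obtain ⟨M, hM⟩ := exists_linearOrder_rank_lex_opp
    (fun x => if x = a then -1 else if x = b then -2 else 4 * r x) L'
  obtain ⟨M', hM'⟩ := exists_linearOrder_rank_lex (fun x => if x = a then 0 else 1) L'
  have hasymm : ∀ x y, L'.lt x y → ¬ L'.lt y x := fun x y => @lt_asymm _ L'.toPreorder x y
  have htot : ∀ x y, x ≠ y → L'.lt x y ∨ L'.lt y x :=
    fun x y => @lt_or_gt_of_ne _ L' x y
  have hrange := hr.range
  have hlt := hr.lt_of_lt
  have hbt := hr.bot_lt_top
  refine ⟨M, M', isLinExt_iff_lt.2 ?_, isLinExt_iff_lt.2 ?_, ?_, ?_, ?_⟩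
  · intro x y hxy
    rw [hM]
    clear hM hM'
    generalize P.lt = p, L'.lt = l' at *
    grind
  · intro x y hxy
    rw [hM']
    clear hM hM'
    generalize P.lt = p, L'.lt = l' at *
    grind
  · intro x y hxy hne
    simp only [OppositelyOrdered, hM, hM']
    clear hM hM'
    generalize P.lt = p, L'.lt = l' at *
    grind
  · intro x y hxy hyx
    simp only [hM, hM']
    clear hM hM'
    generalize P.lt = p, L'.lt = l' at *
    grind
  · simp only [OppositelyOrdered, hM, hM']
    clear hM hM'
    generalize P.lt = p, L'.lt = l' at *
    grind

theorem IsThreeLayerRank.lt_of_not_reverses {α : Type*} {P : PartialOrder α} {r : α → ℤ}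
    (hr : IsThreeLayerRank P r) {L : LinearOrder α} (hL : IsLinExt P L) (hrev : ¬ Reverses P L) :
    ∀ x y, r x < r y → L.lt x y := by
  intro x y hxy
  rw [isLinExt_iff_lt] at hL
  by_cases hlt : P.lt x y
  · exact hL x y hlt
  have hrange := hr.range
  have hmono := hr.lt_of_lt
  have hbt := hr.bot_lt_top
  have hle : ∀ s t, P.le s t → P.lt s t ∨ s = t :=
    fun s t => @lt_or_eq_of_le _ P s t
  by_contra hn
  have hyx : L.lt y x := (lt_or_gt_of_ne (by rintro rfl; omega : x ≠ y)).resolve_left hn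
  refine hrev ⟨x, y, ⟨?_, ?_, ?_, ?_⟩, hyx⟩ <;>
    generalize P.le = q, P.lt = p, L.lt = l at * <;> grind

theorem IsThreeLayerRank.not_isDiametralPair {α : Type*} [Finite α] {P : PartialOrder α}
    {r : α → ℤ} (hr : IsThreeLayerRank P r) (hchain : ¬ IsChainOrder P) {L L' : LinearOrder α}
    (hrev : ¬ Reverses P L) : ¬ IsDiametralPair P L L' := by
  rintro ⟨hL, hL', hmax⟩
  have hlayer := hr.lt_of_not_reverses hL hrev
  have hrange := hr.range
  have hmono := hr.lt_of_lt
  have hbt := hr.bot_lt_top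
  have hle : ∀ s t, P.le s t → P.lt s t ∨ s = t :=
    fun s t => @lt_or_eq_of_le _ P s t
  have hasymm : ∀ x y, L.lt x y → ¬ L.lt y x := fun x y => @lt_asymm _ L.toPreorder x y
  have hasymm' : ∀ x y, L'.lt x y → ¬ L'.lt y x := fun x y => @lt_asymm _ L'.toPreorder x y
  have htot : ∀ x y, x ≠ y → L.lt x y ∨ L.lt y x :=
    fun x y => @lt_or_gt_of_ne _ L x y
  have htot' : ∀ x y, x ≠ y → L'.lt x y ∨ L'.lt y x :=
    fun x y => @lt_or_gt_of_ne _ L' x y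
  have htrans' : ∀ x y z, L'.lt x y → L'.lt y z → L'.lt x z :=
    fun x y z => @lt_trans _ L'.toPreorder x y z
  have hext' := isLinExt_iff_lt.1 hL'
  have key : ∀ (M M' : LinearOrder α), IsLinExt P M → IsLinExt P M' →
      (∀ x y, r x = r y → x ≠ y → OppositelyOrdered M M' x y) →
      (∀ x y, r x < r y → L'.lt y x → M.lt x y ∧ M'.lt y x) →
      ∀ u v, OppositelyOrdered M M' u v → OppositelyOrdered L L' u v := by
    intro M M' hM hM' h₁ h₂ u v huv
    by_contra hn
    refine absurd (hmax M M' hM hM') (not_le.2 (leDist_lt_of_oppositelyOrdered ?_ hn huv))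
    intro x y hxy
    rcases lt_trichotomy (r x) (r y) with h | h | h
    · have := hlayer _ _ h
      have := h₂ x y h
      simp only [OppositelyOrdered] at *
      generalize P.le = q, P.lt = p, L.lt = l, L'.lt = l', M.lt = m, M'.lt = m' at *
      grind
    · refine h₁ x y h ?_
      rintro rfl
      simp only [OppositelyOrdered] at hxy
      generalize P.le = q, P.lt = p, L.lt = l, L'.lt = l', M.lt = m, M'.lt = m' at *
      grind
    · have := hlayer _ _ h
      have := h₂ y x h
      simp only [OppositelyOrdered] at *
      generalize P.le = q, P.lt = p, L.lt = l, L'.lt = l', M.lt = m, M'.lt = m' at *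
      grind
  obtain ⟨a₀, ha₀⟩ := hr.exists_bot
  obtain ⟨c₀, hc₀⟩ := hr.exists_top
  obtain ⟨b₀, hb₀, -, -⟩ := hr.exists_between a₀ c₀ ha₀ hc₀
  obtain ⟨b, hb, hlast⟩ : ∃ b, r b = 0 ∧ ∀ x, r x = 0 → x ≠ b → L'.lt x b := by
    obtain ⟨b, hb, hmax⟩ := L'.opp.toPartialOrder.exists_minimal_of_finite (fun x => r x = 0)
      ⟨b₀, hb₀⟩
    exact ⟨b, hb, fun x hx hne => (htot' x b hne).resolve_right (hmax x hx)⟩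
  obtain ⟨b', hb', hfirst⟩ : ∃ b, r b = 0 ∧ ∀ x, r x = 0 → x ≠ b → L'.lt b x := by
    obtain ⟨b, hb, hmin⟩ := L'.toPartialOrder.exists_minimal_of_finite (fun x => r x = 0)
      ⟨b₀, hb₀⟩
    exact ⟨b, hb, fun x hx hne => (htot' x b hne).resolve_left (hmin x hx)⟩
  by_cases hbb : b = b'
  · subst hbb
    have hmid : ∀ x, r x = 0 → x = b := by
      generalize P.le = q, P.lt = p, L.lt = l, L'.lt = l' at *
      grind
    have hiff : ∀ x y, P.lt x y ↔ r x < r y := by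
      intro x y
      refine ⟨hmono x y, fun h => ?_⟩
      have hbtw := hr.exists_between
      rcases hrange x with hx | hx | hx <;> rcases hrange y with hy | hy | hy <;>
        generalize P.le = q, P.lt = p, L.lt = l, L'.lt = l' at * <;> grind
    refine hchain fun x y => ?_
    by_contra! hxy
    have hne : x ≠ y := by
      rintro rfl
      exact hxy.1 (le_refl _)
    have hrxy : r x = r y := by
      by_contra h
      rcases lt_or_gt_of_ne h with h | h
      · exact hxy.1 (le_of_lt ((hiff x y).2 h))
      · exact hxy.2 (le_of_lt ((hiff y x).2 h))
    rcases htot x y hne with h | h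
    · exact hrev ⟨y, x, ⟨hxy.2, hxy.1, by simp only [hiff]; omega, by simp only [hiff]; omega⟩, h⟩
    · exact hrev ⟨x, y, ⟨hxy.1, hxy.2, by simp only [hiff]; omega, by simp only [hiff]; omega⟩, h⟩
  have hb'b : L'.lt b' b := hlast b' hb' (Ne.symm hbb)
  have hLbb : L.lt b b' := by
    obtain ⟨M, hM⟩ := exists_linearOrder_rank_lex_opp r L'
    have := key M L' (isLinExt_iff_lt.2 fun x y h => (hM x y).2 (Or.inl (hmono x y h))) hL'
      (by
        intro x y hxy hne
        simp only [OppositelyOrdered, hM]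
        generalize P.le = q, P.lt = p, L.lt = l, L'.lt = l' at *
        grind)
      (by
        intro x y hxy hyx
        simp only [hM]
        generalize P.le = q, P.lt = p, L.lt = l, L'.lt = l' at *
        grind)
      b' b
      (by
        simp only [OppositelyOrdered, hM]
        generalize P.le = q, P.lt = p, L.lt = l, L'.lt = l' at *
        grind)
    simp only [OppositelyOrdered] at this
    generalize P.le = q, P.lt = p, L.lt = l, L'.lt = l' at *
    grind
  have hnc : ¬ IsCriticalPair P b' b := fun h => hrev ⟨b', b, h, hLbb⟩
  have hor : (∃ z, P.lt z b' ∧ ¬ P.lt z b) ∨ ∃ z, P.lt b z ∧ ¬ P.lt b' z := by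
    by_contra! h
    refine hnc ⟨?_, ?_, h.1, h.2⟩ <;>
      generalize P.le = q, P.lt = p, L.lt = l, L'.lt = l' at * <;> grind
  rcases hor with ⟨a, hab', hab⟩ | ⟨c, hbc, hb'c⟩
  · have ha : r a = -1 := by generalize P.le = q, P.lt = p, L.lt = l, L'.lt = l' at *; grind
    have hfa : ∀ x, r x = 0 → L'.lt a x := by
      generalize P.le = q, P.lt = p, L.lt = l, L'.lt = l' at *
      grind
    obtain ⟨M, M', hM, hM', h₁, h₂, h₃⟩ := hr.exists_improvement hL' ha hb hab hfa hlast
    have := key M M' hM hM' h₁ h₂ a b h₃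
    simp only [OppositelyOrdered] at this
    generalize P.le = q, P.lt = p, L.lt = l, L'.lt = l' at *
    grind
  · have hc : r c = 1 := by generalize P.le = q, P.lt = p, L.lt = l, L'.lt = l' at *; grind
    have hfc : ∀ x, r x = 0 → L'.lt x c := by
      generalize P.le = q, P.lt = p, L.lt = l, L'.lt = l' at *
      grind
    obtain ⟨M, M', hM, hM', h₁, h₂, h₃⟩ := hr.opp.exists_improvement (L' := L'.opp)
      (a := c) (b := b') (fun x y h => hL' y x h) (by simp [hc]) (by simp [hb']) hb'c
      (fun x hx => hfc x (by simpa using hx))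
      (fun x hx hne => hfirst x (by simpa using hx) hne)
    have := key M.opp M'.opp (fun x y h => hM y x h) (fun x y h => hM' y x h)
      (fun x y hxy hne => h₁ y x (by simp [hxy]) hne.symm)
      (fun x y hxy hyx => h₂ y x (by simpa using hxy) hyx) b' c h₃
    have := hlayer b' c (by omega)
    have := hfc b' hb'
    simp only [OppositelyOrdered] at *
    generalize P.le = q, P.lt = p, L.lt = l, L'.lt = l' at *
    grind

/-- Every 3-layer poset which is not a chain is diametrally reversing: if every maximal
chain has exactly 3 elements and every minimal element is strictly below every maximal
element, then the poset is diametrally reversing. -/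
theorem statement_12 {α : Type*} [Fintype α] [Nonempty α] (P : PartialOrder α)
    (hmc : ∀ C : Set α, IsMaxChain P.le C → C.ncard = 3)
    (hmm : ∀ a c : α, (∀ z, ¬ P.lt z a) → (∀ z, ¬ P.lt c z) → P.lt a c)
    (hchain : ¬ IsChainOrder P) :
    DiametrallyReversing P := by
  obtain ⟨r, hr⟩ := exists_isThreeLayerRank P hmc hmm
  rintro L ⟨L', h | ⟨h₁, h₂, h₃⟩⟩ <;> by_contra hrev
  · exact hr.not_isDiametralPair hchain hrev h
  · refine hr.not_isDiametralPair hchain hrev (L' := L') ⟨h₂, h₁, fun M₁ M₂ hM₁ hM₂ => ?_⟩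
    rw [leDist_comm L L']
    exact h₃ M₁ M₂ hM₁ hM₂
end

section
/- Let P be a partial order on a finite type admitting a realiser of size 2, i.e., two linear extensions M₁, M₂ such that for all x, y: x ≤ y in P if and only if x ≤ y in M₁ and x ≤ y in M₂. Then led(P) equals the number of unordered pairs {x, y} of incomparable elements of P. -/
/-- Forgetting the order of a pair is injective on the pairs reversed between two linear orders. -/
theorem injOn_sym2_reversed_pairs {α : Type*} (L₁ L₂ : LinearOrder α) :
    Set.InjOn (fun p : α × α => s(p.1, p.2)) {p | L₁.lt p.1 p.2 ∧ L₂.lt p.2 p.1} := by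
  rintro ⟨a, b⟩ ⟨hab, -⟩ ⟨c, d⟩ ⟨hcd, -⟩ h
  rcases Sym2.eq_iff.1 h with ⟨rfl, rfl⟩ | ⟨rfl, rfl⟩
  · rfl
  · exact absurd hcd (@lt_asymm _ L₁.toPreorder _ _ hab)

/-- The unordered incomparable pairs of `P`. -/
def incomparablePairs {α : Type*} (P : PartialOrder α) : Set (Sym2 α) :=
  {s | ∃ x y : α, s = s(x, y) ∧ ¬ P.le x y ∧ ¬ P.le y x}

/-- Linear extensions only reverse incomparable pairs. -/
theorem image_reversed_pairs_subset {α : Type*} {P : PartialOrder α} {L₁ L₂ : LinearOrder α}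
    (h₁ : IsLinExt P L₁) (h₂ : IsLinExt P L₂) :
    (fun p : α × α => s(p.1, p.2)) '' {p | L₁.lt p.1 p.2 ∧ L₂.lt p.2 p.1} ⊆
      incomparablePairs P := by
  rintro _ ⟨⟨a, b⟩, ⟨hab, hba⟩, rfl⟩
  exact ⟨a, b, rfl, fun h => @not_le_of_gt _ L₂.toPreorder _ _ hba (h₂ a b h),
    fun h => @not_le_of_gt _ L₁.toPreorder _ _ hab (h₁ b a h)⟩

/-- A realiser of size 2 reverses every incomparable pair. -/
theorem incomparablePairs_subset_image {α : Type*} {P : PartialOrder α} {M₁ M₂ : LinearOrder α}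
    (hreal : ∀ x y : α, P.le x y ↔ (M₁.le x y ∧ M₂.le x y)) :
    incomparablePairs P ⊆
      (fun p : α × α => s(p.1, p.2)) '' {p | M₁.lt p.1 p.2 ∧ M₂.lt p.2 p.1} := by
  rintro _ ⟨x, y, rfl, hxy, hyx⟩
  rw [hreal, not_and] at hxy hyx
  rcases M₁.le_total x y with h | h
  · have h₂ := @lt_of_not_ge _ M₂ _ _ (hxy h)
    refine ⟨(x, y), ⟨@lt_of_not_ge _ M₁ _ _ fun h' => ?_, h₂⟩, rfl⟩
    exact hyx h' (@le_of_lt _ M₂.toPreorder _ _ h₂)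
  · have h₂ := @lt_of_not_ge _ M₂ _ _ (hyx h)
    refine ⟨(y, x), ⟨@lt_of_not_ge _ M₁ _ _ fun h' => ?_, h₂⟩, Sym2.eq_swap⟩
    exact hxy h' (@le_of_lt _ M₂.toPreorder _ _ h₂)

/-- The distance between two linear extensions is at most the number of incomparable pairs. -/
theorem leDist_le_ncard_incomparablePairs {α : Type*} [Finite α] {P : PartialOrder α}
    {L₁ L₂ : LinearOrder α} (h₁ : IsLinExt P L₁) (h₂ : IsLinExt P L₂) :
    leDist L₁ L₂ ≤ (incomparablePairs P).ncard := by
  rw [leDist, ← (injOn_sym2_reversed_pairs L₁ L₂).ncard_image]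
  exact Set.ncard_le_ncard (image_reversed_pairs_subset h₁ h₂) (Set.toFinite _)

/-- If `P` has a realiser of size 2, then `led P` equals the number of unordered
incomparable pairs of `P`. -/
theorem statement_15 {α : Type*} [Fintype α] (P : PartialOrder α)
    (M₁ M₂ : LinearOrder α) (h₁ : IsLinExt P M₁) (h₂ : IsLinExt P M₂)
    (hreal : ∀ x y : α, P.le x y ↔ (M₁.le x y ∧ M₂.le x y)) :
    led P = Set.ncard {s : Sym2 α | ∃ x y : α, s = s(x, y) ∧ ¬ P.le x y ∧ ¬ P.le y x} := by
  change led P = (incomparablePairs P).ncard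
  have hM : leDist M₁ M₂ = (incomparablePairs P).ncard := by
    rw [leDist, ← (injOn_sym2_reversed_pairs M₁ M₂).ncard_image,
      (image_reversed_pairs_subset h₁ h₂).antisymm (incomparablePairs_subset_image hreal)]
  refine IsGreatest.csSup_eq ⟨⟨M₁, M₂, h₁, h₂, hM⟩, ?_⟩
  rintro _ ⟨L₁, L₂, hL₁, hL₂, rfl⟩
  exact leDist_le_ncard_incomparablePairs hL₁ hL₂
end
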